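/- arXiv:1202.4427 — 11 statements merged into one kernel-verified Lean document; each statement's English description precedes it below -/
import Mathlib

section
/- For every graph G on n vertices, the number of maximal independent sets of G satisfies mis(G) ≤ 3^{n/3}, i.e. mis(G)³ ≤ 3ⁿ. -/
/-- The number of maximal independent sets of a graph `G`. -/
noncomputable def mis {V : Type*} (G : SimpleGraph V) : ℕ :=
  {I : Set V | Maximal (fun s : Set V => s.Pairwise fun a b => ¬ G.Adj a b) I}.ncard

theorem Nat.pow_three_le_three_pow (k : ℕ) : k ^ 3 ≤ 3 ^ k := by
  rcases Nat.lt_or_ge k 3 with h | h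
  · interval_cases k <;> norm_num
  · induction k, h using Nat.le_induction with
    | base => norm_num
    | succ k hk ih =>
      have : (k + 1) ^ 3 ≤ 3 * k ^ 3 := by
        obtain ⟨m, rfl⟩ := Nat.exists_eq_add_of_le hk
        nlinarith [Nat.zero_le (m ^ 3), Nat.zero_le (m ^ 2)]
      rw [pow_succ 3 k]
      lia

namespace SimpleGraph

open Classical Finset

variable {V : Type*} (G : SimpleGraph V)

/-- The maximal independent sets of the subgraph of `G` induced by `S`. -/
noncomputable def maximalIndepSetsIn (S : Finset V) : Finset (Finset V) :=
  S.powerset.filter fun I =>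
    G.IsIndepSet (I : Set V) ∧ ∀ x ∈ S, x ∉ I → ∃ y ∈ I, G.Adj x y

/-- The closed neighborhood of `v` in the subgraph of `G` induced by `S`, for `v ∈ S`. -/
noncomputable def closedNeighborsIn (S : Finset V) (v : V) : Finset V :=
  S.filter fun u => u = v ∨ G.Adj v u

variable {G}

theorem mem_maximalIndepSetsIn {S I : Finset V} : I ∈ G.maximalIndepSetsIn S ↔
    I ⊆ S ∧ G.IsIndepSet (I : Set V) ∧ ∀ x ∈ S, x ∉ I → ∃ y ∈ I, G.Adj x y := by
  simp [maximalIndepSetsIn]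

theorem mem_closedNeighborsIn {S : Finset V} {u v : V} :
    u ∈ G.closedNeighborsIn S v ↔ u ∈ S ∧ (u = v ∨ G.Adj v u) := by
  simp [closedNeighborsIn]

theorem erase_mem_maximalIndepSetsIn {S I : Finset V} {u : V}
    (hI : I ∈ G.maximalIndepSetsIn S) (hu : u ∈ I) :
    I.erase u ∈ G.maximalIndepSetsIn (S \ G.closedNeighborsIn S u) := by
  obtain ⟨hS, hind, hmax⟩ := mem_maximalIndepSetsIn.1 hI
  refine mem_maximalIndepSetsIn.2 ⟨fun x hx => ?_, hind.mono (by simp), fun x hx hxI => ?_⟩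
  · obtain ⟨hxu, hxI⟩ := mem_erase.1 hx
    have : ¬ G.Adj u x := hind hu hxI hxu.symm
    simp [mem_closedNeighborsIn, hS hxI, hxu, this]
  · simp only [mem_sdiff, mem_closedNeighborsIn, not_and, not_or] at hx
    obtain ⟨hxS, hx⟩ := hx
    obtain ⟨hxu, hadj⟩ := hx hxS
    obtain ⟨y, hy, hxy⟩ := hmax x hxS fun h => hxI (mem_erase.2 ⟨hxu, h⟩)
    refine ⟨y, mem_erase.2 ⟨?_, hy⟩, hxy⟩
    rintro rfl
    exact hadj hxy.symm

theorem card_maximalIndepSetsIn_le_sum {S : Finset V} {v : V} (hv : v ∈ S) :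
    #(G.maximalIndepSetsIn S) ≤
      ∑ u ∈ G.closedNeighborsIn S v, #(G.maximalIndepSetsIn (S \ G.closedNeighborsIn S u)) := by
  have hsub : G.maximalIndepSetsIn S ⊆ (G.closedNeighborsIn S v).biUnion fun u =>
      (G.maximalIndepSetsIn (S \ G.closedNeighborsIn S u)).image (insert u) := by
    intro I hI
    obtain ⟨hS, -, hmax⟩ := mem_maximalIndepSetsIn.1 hI
    obtain ⟨u, hu, huv⟩ : ∃ u ∈ I, u = v ∨ G.Adj v u := by
      by_cases h : v ∈ I
      · exact ⟨v, h, Or.inl rfl⟩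
      · obtain ⟨y, hy, hvy⟩ := hmax v hv h
        exact ⟨y, hy, Or.inr hvy⟩
    exact mem_biUnion.2 ⟨u, mem_closedNeighborsIn.2 ⟨hS hu, huv⟩,
      mem_image.2 ⟨I.erase u, erase_mem_maximalIndepSetsIn hI hu, insert_erase hu⟩⟩
  exact (card_le_card hsub).trans (card_biUnion_le.trans (sum_le_sum fun _ _ => card_image_le))

theorem card_maximalIndepSetsIn_pow_three_le (S : Finset V) :
    #(G.maximalIndepSetsIn S) ^ 3 ≤ 3 ^ #S := by
  induction S using Finset.strongInduction with
  | H S ih =>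
    rcases S.eq_empty_or_nonempty with rfl | hne
    · have : #(G.maximalIndepSetsIn ∅) ≤ 1 := (card_filter_le _ _).trans (by simp)
      simpa using Nat.pow_le_pow_left this 3
    obtain ⟨v, hv, hmin⟩ := S.exists_min_image (fun v => #(G.closedNeighborsIn S v)) hne
    set k := #(G.closedNeighborsIn S v)
    have hself : ∀ u ∈ S, u ∈ G.closedNeighborsIn S u := fun u hu =>
      mem_closedNeighborsIn.2 ⟨hu, Or.inl rfl⟩
    have hN : ∀ u, G.closedNeighborsIn S u ⊆ S := fun u => filter_subset _ _
    obtain ⟨w, hw, hwmax⟩ := (G.closedNeighborsIn S v).exists_max_image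
      (fun u => #(G.maximalIndepSetsIn (S \ G.closedNeighborsIn S u))) ⟨v, hself v hv⟩
    have hwS := hN v hw
    have hcard : #(S \ G.closedNeighborsIn S w) ≤ #S - k := by
      rw [card_sdiff_of_subset (hN w)]
      exact Nat.sub_le_sub_left (hmin w hwS) _
    have hle := (card_maximalIndepSetsIn_le_sum hv).trans (sum_le_card_nsmul _ _ _ hwmax)
    calc #(G.maximalIndepSetsIn S) ^ 3
        ≤ (k * #(G.maximalIndepSetsIn (S \ G.closedNeighborsIn S w))) ^ 3 :=
          Nat.pow_le_pow_left hle 3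
      _ = k ^ 3 * #(G.maximalIndepSetsIn (S \ G.closedNeighborsIn S w)) ^ 3 := mul_pow _ _ _
      _ ≤ 3 ^ k * 3 ^ (#S - k) := by
          refine Nat.mul_le_mul (Nat.pow_three_le_three_pow k) ((ih _ ?_).trans ?_)
          · exact sdiff_ssubset (hN w) ⟨w, hself w hwS⟩
          · exact Nat.pow_le_pow_right (by norm_num) hcard
      _ = 3 ^ #S := by
          rw [← pow_add, Nat.add_sub_cancel' (card_le_card (hN v))]

theorem toFinset_mem_maximalIndepSetsIn_univ [Fintype V] {I : Set V}
    (hI : Maximal G.IsIndepSet I) : I.toFinset ∈ G.maximalIndepSetsIn univ := by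
  refine mem_maximalIndepSetsIn.2 ⟨subset_univ _, by simpa using hI.prop, fun x _ hx => ?_⟩
  rw [Set.mem_toFinset] at hx
  by_contra! hadj
  have hins : G.IsIndepSet (insert x I) := hI.prop.insert fun y hy _ =>
    ⟨hadj y (Set.mem_toFinset.2 hy), fun h => hadj y (Set.mem_toFinset.2 hy) h.symm⟩
  exact hx (hI.le_of_ge hins (Set.subset_insert x I) (Set.mem_insert x I))

theorem mis_le_card_maximalIndepSetsIn_univ [Fintype V] :
    mis G ≤ #(G.maximalIndepSetsIn univ) := by
  rw [← Set.ncard_coe_finset]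
  exact Set.ncard_le_ncard_of_injOn (fun I => I.toFinset)
    (fun I hI => toFinset_mem_maximalIndepSetsIn_univ hI)
    (fun I _ J _ h => Set.toFinset_inj.1 h)

end SimpleGraph

theorem mis_le_three_pow_third (V : Type*) [Fintype V] (G : SimpleGraph V) :
    (mis G) ^ 3 ≤ 3 ^ (Fintype.card V) :=
  (Nat.pow_le_pow_left SimpleGraph.mis_le_card_maximalIndepSetsIn_univ 3).trans
    (SimpleGraph.card_maximalIndepSetsIn_pow_three_le Finset.univ)
end

section
/- For every triangle-free graph G on n vertices, the number of maximal independent sets of G satisfies mis(G) ≤ 2^{n/2}, i.e. mis(G)² ≤ 2ⁿ. -/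
open scoped Finset

open Classical in
/-- The maximal independent sets of the subgraph of `G` induced on `U`: independent subsets of `U`
that dominate `U`. -/
noncomputable def maximalIndepFinsets {V : Type*} (G : SimpleGraph V) (U : Finset V) :
    Finset (Finset V) :=
  {I ∈ U.powerset | (∀ a ∈ I, ∀ b ∈ I, ¬ G.Adj a b) ∧ ∀ v ∈ U, v ∉ I → ∃ w ∈ I, G.Adj v w}

theorem mem_maximalIndepFinsets {V : Type*} {G : SimpleGraph V} {U I : Finset V} :
    I ∈ maximalIndepFinsets G U ↔ I ⊆ U ∧ (∀ a ∈ I, ∀ b ∈ I, ¬ G.Adj a b) ∧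
      ∀ v ∈ U, v ∉ I → ∃ w ∈ I, G.Adj v w := by
  simp [maximalIndepFinsets]

open Classical in
/-- Deleting `S` and its neighbours injects the maximal independent sets containing `S` into those
of the remaining graph. -/
theorem card_maximalIndepFinsets_superset_le {V : Type*} (G : SimpleGraph V) (U S : Finset V) :
    #{I ∈ maximalIndepFinsets G U | S ⊆ I} ≤
      #(maximalIndepFinsets G {t ∈ U | ∀ x ∈ S, t ≠ x ∧ ¬ G.Adj x t}) := by
  refine Finset.card_le_card_of_injOn (fun I => I \ S) ?_ ?_
  · intro I hI
    obtain ⟨hI, hS⟩ := Finset.mem_filter.1 hI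
    obtain ⟨hU, hind, hdom⟩ := mem_maximalIndepFinsets.1 hI
    refine mem_maximalIndepFinsets.2 ⟨fun x hx => ?_, fun a ha b hb => ?_, fun v hv hvI => ?_⟩
    · rw [Finset.mem_sdiff] at hx
      exact Finset.mem_filter.2 ⟨hU hx.1, fun y hy =>
        ⟨fun h => hx.2 (h ▸ hy), hind y (hS hy) x hx.1⟩⟩
    · exact hind a (Finset.mem_sdiff.1 ha).1 b (Finset.mem_sdiff.1 hb).1
    · obtain ⟨hvU, hvS⟩ := Finset.mem_filter.1 hv
      have hvS' : v ∉ S := fun h => (hvS v h).1 rfl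
      obtain ⟨w, hw, hvw⟩ := hdom v hvU fun h => hvI (Finset.mem_sdiff.2 ⟨h, hvS'⟩)
      exact ⟨w, Finset.mem_sdiff.2 ⟨hw, fun h => (hvS w h).2 hvw.symm⟩, hvw⟩
  · intro I hI J hJ h
    rw [← Finset.sdiff_union_of_subset (Finset.mem_filter.1 hI).2,
      ← Finset.sdiff_union_of_subset (Finset.mem_filter.1 hJ).2]
    exact congrArg (· ∪ S) h

theorem natCast_le_sqrt_two_pow (d : ℕ) (hd : d ≠ 3) : (d : ℝ) ≤ √2 ^ d := by
  have h2 : √2 ^ 2 = (2 : ℝ) := Real.sq_sqrt (by norm_num)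
  have h1 : (1.4 : ℝ) ≤ √2 := Real.le_sqrt_of_sq_le (by norm_num)
  rcases Nat.lt_or_ge d 4 with h | h
  · interval_cases d
    · simp
    · norm_num
    · simp [h2]
    · exact absurd rfl hd
  · clear hd
    induction d, h using Nat.le_induction with
    | base => rw [show (4 : ℕ) = 2 * 2 from rfl, pow_mul, h2]; norm_num
    | succ n hn ih =>
      have : (4 : ℝ) ≤ n := by exact_mod_cast hn
      rw [pow_succ]
      push_cast
      nlinarith

theorem card_le_card_filter_add_card_filter {α : Type*} (M : Finset α) (p q : α → Prop)
    [DecidablePred p] [DecidablePred q] (h : ∀ x ∈ M, p x ∨ q x) :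
    #M ≤ #{x ∈ M | p x} + #{x ∈ M | q x} := by
  classical
  refine (Finset.card_le_card ?_).trans (Finset.card_union_le _ _)
  intro x hx
  have := h x hx
  simp [hx, this]

open Classical in
theorem card_maximalIndepFinsets_superset_mul_le {V : Type*} {G : SimpleGraph V} {U : Finset V}
    (ih : ∀ W ⊂ U, (#(maximalIndepFinsets G W) : ℝ) ≤ √2 ^ #W) (S T : Finset V)
    (hT : T.Nonempty) (hTU : T ⊆ U) (hST : ∀ t ∈ T, ∃ x ∈ S, t = x ∨ G.Adj x t) :
    (#{I ∈ maximalIndepFinsets G U | S ⊆ I} : ℝ) * √2 ^ #T ≤ √2 ^ #U := by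
  set W : Finset V := {t ∈ U | ∀ x ∈ S, t ≠ x ∧ ¬ G.Adj x t}
  have hWT : W ⊆ U \ T := by
    intro t ht
    obtain ⟨htU, h⟩ := Finset.mem_filter.1 ht
    refine Finset.mem_sdiff.2 ⟨htU, fun htT => ?_⟩
    obtain ⟨x, hx, hx'⟩ := hST t htT
    exact hx'.elim (h x hx).1 (h x hx).2
  have h1 : (1 : ℝ) ≤ √2 := Real.one_le_sqrt.2 (by norm_num)
  have hlt : W ⊂ U := by
    refine (Finset.ssubset_iff_of_subset (hWT.trans Finset.sdiff_subset)).2 ?_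
    obtain ⟨t, ht⟩ := hT
    exact ⟨t, hTU ht, fun h => (Finset.mem_sdiff.1 (hWT h)).2 ht⟩
  calc (#{I ∈ maximalIndepFinsets G U | S ⊆ I} : ℝ) * √2 ^ #T
      ≤ √2 ^ #(U \ T) * √2 ^ #T := by
        refine mul_le_mul_of_nonneg_right ?_ (by positivity)
        refine le_trans ?_ ((ih W hlt).trans (pow_le_pow_right₀ h1 (Finset.card_le_card hWT)))
        exact_mod_cast card_maximalIndepFinsets_superset_le G U S
    _ = √2 ^ #U := by rw [← pow_add, Finset.card_sdiff_add_card_eq_card hTU]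

open Classical in
/-- The branching step at a vertex of minimum degree two. -/
theorem card_maximalIndepFinsets_le_of_degree_two {V : Type*} {G : SimpleGraph V}
    (htf : G.CliqueFree 3) {U : Finset V}
    (ih : ∀ W ⊂ U, (#(maximalIndepFinsets G W) : ℝ) ≤ √2 ^ #W) {v : V} (hv : v ∈ U)
    (hdeg : #{w ∈ U | G.Adj v w} = 2) (hmin : ∀ u ∈ U, 2 ≤ #{w ∈ U | G.Adj u w}) :
    (#(maximalIndepFinsets G U) : ℝ) ≤ √2 ^ #U := by
  have hs2 : √2 ^ 2 = (2 : ℝ) := Real.sq_sqrt (by norm_num)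
  have hs15 : √2 ≤ (1.5 : ℝ) := Real.sqrt_le_iff.2 (by norm_num)
  have hs0 : (0 : ℝ) < √2 := by positivity
  have hX : (0 : ℝ) < √2 ^ #U := by positivity
  set X : ℝ := √2 ^ #U
  have hsX : √2 * X ≤ 1.5 * X := mul_le_mul_of_nonneg_right hs15 hX.le
  have hX2 : X ≤ √2 * X := le_mul_of_one_le_left hX.le (Real.one_le_sqrt.2 (by norm_num))
  set M := maximalIndepFinsets G U
  have bound3 : ∀ c : ℝ, c * √2 ^ 3 ≤ X → c ≤ √2 / 4 * X := fun c hc => by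
    have h := mul_le_mul_of_nonneg_left hc hs0.le
    rw [show √2 * (c * √2 ^ 3) = c * (√2 ^ 2) ^ 2 by ring, hs2] at h
    linarith
  have bound4 : ∀ (c : ℝ) (k : ℕ), 0 ≤ c → 4 ≤ k → c * √2 ^ k ≤ X → c ≤ 1 / 4 * X :=
    fun c k hc0 hk hc => by
      have h := pow_le_pow_right₀ (Real.one_le_sqrt.2 (by norm_num : (1 : ℝ) ≤ 2)) hk
      rw [show √2 ^ 4 = (√2 ^ 2) ^ 2 by ring, hs2] at h
      nlinarith
  have bound5 : ∀ c : ℝ, c * √2 ^ 5 ≤ X → c ≤ √2 / 8 * X := fun c hc => by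
    have h := mul_le_mul_of_nonneg_left hc hs0.le
    rw [show √2 * (c * √2 ^ 5) = c * (√2 ^ 2) ^ 3 by ring, hs2] at h
    linarith
  have key := card_maximalIndepFinsets_superset_mul_le ih
  have star : ∀ u ∈ U, (#{I ∈ M | {u} ⊆ I} : ℝ) * √2 ^ (#{w ∈ U | G.Adj u w} + 1) ≤ X := by
    intro u hu
    have := key {u} (insert u {w ∈ U | G.Adj u w}) (by simp)
      (Finset.insert_subset hu (Finset.filter_subset _ _)) (by simp +contextual)
    rwa [Finset.card_insert_of_notMem (by simp)] at this
  obtain ⟨a, b, hab, hD⟩ := Finset.card_eq_two.1 hdeg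
  have hmem : ∀ w, (w ∈ U ∧ G.Adj v w) ↔ w = a ∨ w = b := fun w => by
    rw [← Finset.mem_filter, hD]; simp
  obtain ⟨haU, hva⟩ := (hmem a).2 (Or.inl rfl)
  obtain ⟨hbU, hvb⟩ := (hmem b).2 (Or.inr rfl)
  have hnab : ¬ G.Adj a b := fun h =>
    htf {v, a, b} (SimpleGraph.is3Clique_triple_iff.2 ⟨hva, hvb, h⟩)
  have hcov : ∀ I ∈ M, v ∈ I ∨ a ∈ I ∨ b ∈ I := by
    intro I hI
    obtain ⟨hIU, -, hdom⟩ := mem_maximalIndepFinsets.1 hI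
    by_contra! h
    obtain ⟨w, hw, hvw⟩ := hdom v hv h.1
    rcases (hmem w).1 ⟨hIU hw, hvw⟩ with rfl | rfl
    exacts [h.2.1 hw, h.2.2 hw]
  have hcv : (#{I ∈ M | {v} ⊆ I} : ℝ) ≤ √2 / 4 * X := by
    have h := star v hv
    rw [hdeg] at h
    exact bound3 _ h
  have hsplit : (#M : ℝ) ≤ #{I ∈ M | {v} ⊆ I} +
      (#{I ∈ M | {a} ⊆ I} + #{I ∈ M | {b} ⊆ I}) := by
    have hsub : M ⊆ {I ∈ M | {v} ⊆ I} ∪ ({I ∈ M | {a} ⊆ I} ∪ {I ∈ M | {b} ⊆ I}) := by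
      intro I hI
      simpa [hI] using hcov I hI
    exact_mod_cast (Finset.card_le_card hsub).trans <| (Finset.card_union_le _ _).trans <|
      Nat.add_le_add_left (Finset.card_union_le _ _) _
  have small : ∀ u ∈ U, (#{I ∈ M | {u} ⊆ I} : ℝ) ≤ √2 / 4 * X ∧
      (#{w ∈ U | G.Adj u w} ≠ 2 → (#{I ∈ M | {u} ⊆ I} : ℝ) ≤ 1 / 4 * X) := by
    intro u hu
    have h4 : #{w ∈ U | G.Adj u w} ≠ 2 → (#{I ∈ M | {u} ⊆ I} : ℝ) ≤ 1 / 4 * X := fun h =>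
      bound4 _ _ (by positivity) (by have := hmin u hu; omega) (star u hu)
    refine ⟨?_, h4⟩
    by_cases h : #{w ∈ U | G.Adj u w} = 2
    · have h' := star u hu
      rw [h] at h'
      exact bound3 _ h'
    · linarith [h4 h]
  by_cases hda : #{w ∈ U | G.Adj a w} = 2
  swap
  · linarith [(small a haU).2 hda, (small b hbU).1]
  by_cases hdb : #{w ∈ U | G.Adj b w} = 2
  swap
  · linarith [(small a haU).1, (small b hbU).2 hdb]
  have other : ∀ u, #{w ∈ U | G.Adj u w} = 2 → G.Adj u v →
      ∃ c, c ≠ v ∧ c ∈ U ∧ G.Adj u c ∧ ∀ w ∈ U, G.Adj u w → w = v ∨ w = c := by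
    intro u hu huv
    have hvu : v ∈ ({w ∈ U | G.Adj u w} : Finset V) := Finset.mem_filter.2 ⟨hv, huv⟩
    obtain ⟨c, hc⟩ := Finset.card_eq_one.1
      (by rw [Finset.card_erase_of_mem hvu, hu] : #(({w ∈ U | G.Adj u w} : Finset V).erase v) = 1)
    have hc' : ∀ w, w ∈ ({w ∈ U | G.Adj u w} : Finset V).erase v ↔ w = c := by simp [hc]
    simp only [Finset.mem_erase, Finset.mem_filter] at hc'
    obtain ⟨h1, h2, h3⟩ := (hc' c).2 rfl
    refine ⟨c, h1, h2, h3, fun w hw huw => ?_⟩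
    by_cases hwv : w = v
    exacts [Or.inl hwv, Or.inr ((hc' w).1 ⟨hwv, hw, huw⟩)]
  obtain ⟨c, hcv', hcU, hac, hNa⟩ := other a hda hva.symm
  obtain ⟨d, hdv', hdU, hbd, hNb⟩ := other b hdb hvb.symm
  have hcb : c ≠ b := fun h => hnab (h ▸ hac)
  have hda' : d ≠ a := fun h => hnab (h ▸ hbd).symm
  have hvanot := hva.ne
  have hvbnot := hvb.ne
  have hacnot := hac.ne
  have hbdnot := hbd.ne
  by_cases hcd : c = d
  · subst hcd
    have h1 := card_le_card_filter_add_card_filter M (fun I => {v} ⊆ I) (fun I => {a, b} ⊆ I) (by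
      intro I hI
      obtain ⟨hIU, hind, hdom⟩ := mem_maximalIndepFinsets.1 hI
      simp only [Finset.insert_subset_iff, Finset.singleton_subset_iff]
      by_contra! h
      obtain ⟨hvI, hn⟩ := h
      have hmutual : a ∈ I ↔ b ∈ I := by
        constructor
        · intro ha
          by_contra hb
          obtain ⟨w, hw, hbw⟩ := hdom b hbU hb
          rcases hNb w (hIU hw) hbw with rfl | rfl
          exacts [hvI hw, hind a ha _ hw hac]
        · intro hb
          by_contra ha
          obtain ⟨w, hw, haw⟩ := hdom a haU ha
          rcases hNa w (hIU hw) haw with rfl | rfl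
          exacts [hvI hw, hind b hb _ hw hbd]
      rcases hcov I hI with h | h | h
      exacts [hvI h, hn h (hmutual.1 h), hn (hmutual.2 h) h])
    have h2 := key {a, b} {v, a, b, c} (by simp) (by simp [Finset.insert_subset_iff, *])
      (by simp [hva.symm, hac])
    rw [show #({v, a, b, c} : Finset V) = 4 by grind] at h2
    have h3 := bound4 _ _ (by positivity) le_rfl h2
    have h1' : (#M : ℝ) ≤ #{I ∈ M | {v} ⊆ I} + #{I ∈ M | {a, b} ⊆ I} := by exact_mod_cast h1
    linarith
  · have hT : #({v, a, b, c, d} : Finset V) = 5 := by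
      grind
    have five : ∀ S : Finset V, (∀ t ∈ ({v, a, b, c, d} : Finset V), ∃ x ∈ S, t = x ∨ G.Adj x t) →
        (#{I ∈ M | S ⊆ I} : ℝ) ≤ √2 / 8 * X := fun S hS => bound5 _ (by
      simpa only [hT] using key S {v, a, b, c, d} (by simp)
        (by simp [Finset.insert_subset_iff, *]) hS)
    have hab5 := five {a, b} (by simp [hva.symm, hac, hbd])
    have had5 := five {a, d} (by simp [hva.symm, hac, hbd.symm])
    have hbc5 := five {b, c} (by simp [hvb.symm, hac.symm, hbd])
    have h1 : #M ≤ #{I ∈ M | {v} ⊆ I} + (#{I ∈ M | {a, b} ⊆ I} +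
        (#{I ∈ M | {a, d} ⊆ I} + #{I ∈ M | {b, c} ⊆ I})) := by
      have hsub : M ⊆ {I ∈ M | {v} ⊆ I} ∪ ({I ∈ M | {a, b} ⊆ I} ∪
          ({I ∈ M | {a, d} ⊆ I} ∪ {I ∈ M | {b, c} ⊆ I})) := by
        intro I hI
        obtain ⟨hIU, hind, hdom⟩ := mem_maximalIndepFinsets.1 hI
        simp only [Finset.mem_union, Finset.mem_filter, hI, true_and, Finset.insert_subset_iff,
          Finset.singleton_subset_iff]
        by_cases hvI : v ∈ I
        · exact Or.inl hvI
        have hbd' : b ∉ I → d ∈ I := fun hb => by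
          obtain ⟨w, hw, hbw⟩ := hdom b hbU hb
          rcases hNb w (hIU hw) hbw with rfl | rfl
          exacts [absurd hw hvI, hw]
        have hac' : a ∉ I → c ∈ I := fun ha => by
          obtain ⟨w, hw, haw⟩ := hdom a haU ha
          rcases hNa w (hIU hw) haw with rfl | rfl
          exacts [absurd hw hvI, hw]
        have := hcov I hI
        tauto
      refine (Finset.card_le_card hsub).trans ?_
      refine (Finset.card_union_le _ _).trans (Nat.add_le_add_left ?_ _)
      exact (Finset.card_union_le _ _).trans (Nat.add_le_add_left (Finset.card_union_le _ _) _)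
    have h1' : (#M : ℝ) ≤ #{I ∈ M | {v} ⊆ I} + (#{I ∈ M | {a, b} ⊆ I} +
        (#{I ∈ M | {a, d} ⊆ I} + #{I ∈ M | {b, c} ⊆ I})) := by exact_mod_cast h1
    linarith

open Classical in
theorem card_maximalIndepFinsets_le {V : Type*} {G : SimpleGraph V} (htf : G.CliqueFree 3)
    (U : Finset V) : (#(maximalIndepFinsets G U) : ℝ) ≤ √2 ^ #U := by
  induction U using Finset.strongInduction with
  | H U ih =>
  rcases U.eq_empty_or_nonempty with rfl | hne
  · have : maximalIndepFinsets G ∅ ⊆ {∅} := fun I hI => by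
      simpa using (mem_maximalIndepFinsets.1 hI).1
    simpa using Finset.card_le_card this
  obtain ⟨v, hv, hmin⟩ := Finset.exists_min_image U (fun u => #{w ∈ U | G.Adj u w}) hne
  by_cases hdeg : #{w ∈ U | G.Adj v w} = 2
  · exact card_maximalIndepFinsets_le_of_degree_two htf ih hv hdeg fun u hu => hdeg ▸ hmin u hu
  set D : Finset V := {w ∈ U | G.Adj v w} with hD
  have hDc : #(insert v D) = #D + 1 := Finset.card_insert_of_notMem (by simp [hD])
  have hcov : #(maximalIndepFinsets G U) ≤
      ∑ u ∈ insert v D, #{I ∈ maximalIndepFinsets G U | {u} ⊆ I} := by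
    refine (Finset.card_le_card ?_).trans Finset.card_biUnion_le
    intro I hI
    obtain ⟨hIU, -, hdom⟩ := mem_maximalIndepFinsets.1 hI
    simp only [Finset.mem_biUnion, Finset.mem_filter, hI, true_and, Finset.singleton_subset_iff]
    by_cases hvI : v ∈ I
    · exact ⟨v, Finset.mem_insert_self _ _, hvI⟩
    · obtain ⟨w, hw, hvw⟩ := hdom v hv hvI
      exact ⟨w, Finset.mem_insert_of_mem (Finset.mem_filter.2 ⟨hIU hw, hvw⟩), hw⟩
  have hterm : ∀ u ∈ insert v D,
      (#{I ∈ maximalIndepFinsets G U | {u} ⊆ I} : ℝ) * √2 ^ (#D + 1) ≤ √2 ^ #U := by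
    intro u hu
    have huU : u ∈ U := (Finset.insert_subset hv (Finset.filter_subset _ _)) hu
    have h := card_maximalIndepFinsets_superset_mul_le ih {u} (insert u {w ∈ U | G.Adj u w})
      (by simp) (Finset.insert_subset huU (Finset.filter_subset _ _)) (by simp +contextual)
    rw [Finset.card_insert_of_notMem (by simp)] at h
    refine le_trans (mul_le_mul_of_nonneg_left ?_ (by positivity)) h
    exact pow_le_pow_right₀ (Real.one_le_sqrt.2 (by norm_num)) (Nat.succ_le_succ (hmin u huU))
  have hpos : (0 : ℝ) < √2 ^ (#D + 1) := by positivity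
  refine le_of_mul_le_mul_right ?_ hpos
  calc (#(maximalIndepFinsets G U) : ℝ) * √2 ^ (#D + 1)
      ≤ (∑ u ∈ insert v D, (#{I ∈ maximalIndepFinsets G U | {u} ⊆ I} : ℝ)) * √2 ^ (#D + 1) :=
        mul_le_mul_of_nonneg_right (by exact_mod_cast hcov) hpos.le
    _ ≤ #(insert v D) • √2 ^ #U := by
        rw [Finset.sum_mul]; exact Finset.sum_le_card_nsmul _ _ _ hterm
    _ = ((#D + 1 : ℕ) : ℝ) * √2 ^ #U := by rw [hDc, nsmul_eq_mul]
    _ ≤ √2 ^ (#D + 1) * √2 ^ #U :=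
        mul_le_mul_of_nonneg_right (natCast_le_sqrt_two_pow _ (by omega)) (by positivity)
    _ = √2 ^ #U * √2 ^ (#D + 1) := mul_comm _ _

theorem mis_le_card_maximalIndepFinsets {V : Type*} [Fintype V] (G : SimpleGraph V) :
    mis G ≤ #(maximalIndepFinsets G Finset.univ) := by
  classical
  rw [mis, ← Set.ncard_coe_finset]
  refine Set.ncard_le_ncard_of_injOn (fun I => I.toFinset) ?_
    (fun I _ J _ h => Set.toFinset_inj.1 h) (Finset.finite_toSet _)
  intro I hI
  rw [Set.mem_ofPred_eq] at hI
  refine mem_maximalIndepFinsets.2 ⟨Finset.subset_univ _, fun a ha b hb hab => ?_,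
    fun v _ hv => ?_⟩
  · exact hI.prop (Set.mem_toFinset.1 ha) (Set.mem_toFinset.1 hb) hab.ne hab
  · by_contra! h
    refine hv (Set.mem_toFinset.2 (hI.mem_of_prop_insert ?_))
    refine hI.prop.insert fun b hb _ => ?_
    have := h b (Set.mem_toFinset.2 hb)
    exact ⟨this, fun h' => this h'.symm⟩

theorem mis_le_two_pow_half_of_triangleFree (V : Type*) [Fintype V] (G : SimpleGraph V)
    (htf : G.CliqueFree 3) :
    (mis G) ^ 2 ≤ 2 ^ (Fintype.card V) := by
  have h : (mis G : ℝ) ≤ √2 ^ Fintype.card V :=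
    (Nat.cast_le.2 (mis_le_card_maximalIndepFinsets G)).trans
      (card_maximalIndepFinsets_le htf Finset.univ)
  have h2 : (mis G : ℝ) ^ 2 ≤ 2 ^ Fintype.card V :=
    calc (mis G : ℝ) ^ 2 ≤ (√2 ^ Fintype.card V) ^ 2 := pow_le_pow_left₀ (by positivity) h 2
      _ = 2 ^ Fintype.card V := by rw [pow_right_comm, Real.sq_sqrt (by norm_num)]
  exact_mod_cast h2
end

section
/- Shearer's Lemma: let X = (X_1, …, X_n) be a random vector of finitely-valued random variables on a finite probability space, and let 𝒜 be a finite multiset of subsets of {1,…,n} such that every index i ∈ {1,…,n} belongs to at least m members of 𝒜 (m ≥ 1). Then H(X) ≤ (1/m) · Σ_{A ∈ 𝒜} H(X_A), where X_A = (X_i : i ∈ A) and H denotes Shannon entropy. -/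
open scoped Classical

/-- The Shannon entropy (base 2) of a finitely-valued random variable `X` on a finite
probability space with probability mass function `p`. -/
noncomputable def ent {Ω E : Type*} [Fintype Ω] [Fintype E] (p : Ω → ℝ) (X : Ω → E) : ℝ :=
  ∑ e : E,
    -((∑ ω : Ω, if X ω = e then p ω else 0) *
      Real.logb 2 (∑ ω : Ω, if X ω = e then p ω else 0))

/-- The probability that `X` takes the value `X ω`. -/
noncomputable def fiberMass {Ω E : Type*} [Fintype Ω] (p : Ω → ℝ) (X : Ω → E) (ω : Ω) : ℝ :=
  ∑ ω', if X ω' = X ω then p ω' else 0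

section Entropy

variable {Ω : Type*} [Fintype Ω] {p : Ω → ℝ}

lemma fiberMass_nonneg {E : Type*} (hp : ∀ ω, 0 ≤ p ω) (X : Ω → E) (ω : Ω) :
    0 ≤ fiberMass p X ω :=
  Finset.sum_nonneg fun ω' _ => by split_ifs <;> simp [hp]

lemma le_fiberMass {E : Type*} (hp : ∀ ω, 0 ≤ p ω) (X : Ω → E) (ω : Ω) :
    p ω ≤ fiberMass p X ω := by
  have h := Finset.single_le_sum (f := fun ω' => if X ω' = X ω then p ω' else 0)
    (fun ω' _ => by split_ifs <;> simp [hp]) (Finset.mem_univ ω)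
  simpa [fiberMass] using h

lemma fiberMass_congr {E F : Type*} {X : Ω → E} {Y : Ω → F} {ω₁ ω₂ : Ω}
    (h : ∀ ω, X ω = X ω₁ ↔ Y ω = Y ω₂) : fiberMass p X ω₁ = fiberMass p Y ω₂ := by
  simp only [fiberMass, h]

lemma fiberMass_mono {E F : Type*} (hp : ∀ ω, 0 ≤ p ω) {X : Ω → E} {Y : Ω → F}
    (h : ∀ ω ω', X ω = X ω' → Y ω = Y ω') (ω : Ω) : fiberMass p X ω ≤ fiberMass p Y ω := by
  refine Finset.sum_le_sum fun ω' _ => ?_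
  by_cases hX : X ω' = X ω
  · simp [hX, h _ _ hX]
  · rw [if_neg hX]
    split_ifs <;> simp [hp]

lemma ent_eq_neg_sum_fiberMass {E : Type*} [Fintype E] (X : Ω → E) :
    ent p X = -∑ ω, p ω * Real.logb 2 (fiberMass p X ω) := by
  simp only [ent, Finset.sum_neg_distrib, Finset.sum_mul, ite_mul, zero_mul]
  rw [Finset.sum_comm]
  simp [fiberMass]

lemma ent_congr {E F : Type*} [Fintype E] [Fintype F] {X : Ω → E} {Y : Ω → F}
    (h : ∀ ω ω', X ω = X ω' ↔ Y ω = Y ω') : ent p X = ent p Y := by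
  simp only [ent_eq_neg_sum_fiberMass, fun ω => fiberMass_congr (p := p) fun ω' => h ω' ω]

lemma ent_mono {E F : Type*} [Fintype E] [Fintype F] (hp : ∀ ω, 0 ≤ p ω) {X : Ω → E}
    {Y : Ω → F} (h : ∀ ω ω', X ω = X ω' → Y ω = Y ω') : ent p Y ≤ ent p X := by
  rw [ent_eq_neg_sum_fiberMass, ent_eq_neg_sum_fiberMass, neg_le_neg_iff]
  refine Finset.sum_le_sum fun ω _ => ?_
  rcases (hp ω).eq_or_lt with h0 | h0
  · simp [← h0]
  · exact mul_le_mul_of_nonneg_left (Real.logb_le_logb_of_le (by norm_num)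
      (h0.trans_le (le_fiberMass hp X ω)) (fiberMass_mono hp h ω)) (hp ω)

lemma ent_eq_zero_of_const {E : Type*} [Fintype E] (hp : ∑ ω, p ω = 1) {X : Ω → E}
    (h : ∀ ω ω', X ω = X ω') : ent p X = 0 := by
  have h1 : ∀ ω, fiberMass p X ω = 1 := fun ω => by simp [fiberMass, h _ ω, hp]
  simp [ent_eq_neg_sum_fiberMass, h1]

lemma sum_fiber_div_fiberMass_le_one {E : Type*} (X : Ω → E) (e : E) :
    ∑ ω, (if X ω = e then p ω / fiberMass p X ω else 0) ≤ 1 := by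
  by_cases he : ∃ ω, X ω = e
  · obtain ⟨ω₀, rfl⟩ := he
    calc _ = ∑ ω, (if X ω = X ω₀ then p ω else 0) / fiberMass p X ω₀ := by
          refine Finset.sum_congr rfl fun ω _ => ?_
          split_ifs with h
          · rw [fiberMass_congr (X := X) (Y := X) (ω₁ := ω) (ω₂ := ω₀) (by simp [h])]
          · simp
      _ = fiberMass p X ω₀ / fiberMass p X ω₀ := by rw [← Finset.sum_div]; rfl
      _ ≤ 1 := div_self_le_one _
  · push Not at he
    simp [he]

lemma sum_fiberMass_ratio_le {E F G K : Type*} (hp : ∀ ω, 0 ≤ p ω) {T : Ω → E} {U : Ω → F}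
    {V : Ω → G} {W : Ω → K} (hT : ∀ ω ω', T ω = T ω' ↔ U ω = U ω' ∧ V ω = V ω')
    (hU : ∀ ω ω', U ω = U ω' → W ω = W ω') (hV : ∀ ω ω', V ω = V ω' → W ω = W ω') :
    ∑ ω, p ω * (fiberMass p U ω * fiberMass p V ω / (fiberMass p T ω * fiberMass p W ω)) ≤
      ∑ ω, p ω := by
  have hUV : ∀ ω, fiberMass p T ω = fiberMass p (fun ω => (U ω, V ω)) ω := fun ω =>
    fiberMass_congr fun ω' => by simp [hT]
  have inner (ω₁ ω₂ : Ω) :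
      ∑ ω, (if U ω₁ = U ω ∧ V ω₂ = V ω then
        p ω₁ * p ω₂ * (p ω / fiberMass p T ω) / fiberMass p W ω else 0) ≤
      if W ω₂ = W ω₁ then p ω₁ * p ω₂ / fiberMass p W ω₁ else 0 := by
    split_ifs with hW
    · calc _ = p ω₁ * p ω₂ / fiberMass p W ω₁ *
            ∑ ω, (if (U ω, V ω) = (U ω₁, V ω₂) then
              p ω / fiberMass p (fun ω => (U ω, V ω)) ω else 0) := by
            rw [Finset.mul_sum]
            refine Finset.sum_congr rfl fun ω _ => ?_
            by_cases h : U ω₁ = U ω ∧ V ω₂ = V ω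
            · rw [if_pos h, if_pos (by simp [h.1, h.2]), hUV,
                fiberMass_congr (X := W) (Y := W) (ω₁ := ω) (ω₂ := ω₁)
                  (by simp [hU _ _ h.1])]
              ring
            · rw [if_neg h, if_neg (by simpa [eq_comm] using h), mul_zero]
        _ ≤ p ω₁ * p ω₂ / fiberMass p W ω₁ * 1 :=
            mul_le_mul_of_nonneg_left
              ((Finset.sum_congr rfl fun _ _ => by congr).trans_le
                (sum_fiber_div_fiberMass_le_one (fun ω => (U ω, V ω)) (U ω₁, V ω₂)))
              (div_nonneg (mul_nonneg (hp _) (hp _)) (fiberMass_nonneg hp _ _))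
        _ = _ := mul_one _
    · refine (Finset.sum_eq_zero fun ω _ => if_neg fun h => hW ?_).le
      rw [hU _ _ h.1, hV _ _ h.2]
  calc _ = ∑ ω, ∑ ω₁, ∑ ω₂, (if U ω₁ = U ω ∧ V ω₂ = V ω then
        p ω₁ * p ω₂ * (p ω / fiberMass p T ω) / fiberMass p W ω else 0) := by
        refine Finset.sum_congr rfl fun ω _ => ?_
        calc _ = (p ω / fiberMass p T ω) / fiberMass p W ω *
              (fiberMass p U ω * fiberMass p V ω) := by ring
          _ = _ := by
            rw [fiberMass.eq_def p U, fiberMass.eq_def p V, Finset.sum_mul_sum, Finset.mul_sum]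
            refine Finset.sum_congr rfl fun ω₁ _ => ?_
            rw [Finset.mul_sum]
            refine Finset.sum_congr rfl fun ω₂ _ => ?_
            by_cases h₁ : U ω₁ = U ω <;> by_cases h₂ : V ω₂ = V ω <;> simp [h₁, h₂]
            ring
    _ = ∑ ω₁, ∑ ω₂, ∑ ω, (if U ω₁ = U ω ∧ V ω₂ = V ω then
        p ω₁ * p ω₂ * (p ω / fiberMass p T ω) / fiberMass p W ω else 0) := by
        rw [Finset.sum_comm]
        exact Finset.sum_congr rfl fun ω₁ _ => Finset.sum_comm
    _ ≤ ∑ ω₁, ∑ ω₂, (if W ω₂ = W ω₁ then p ω₁ * p ω₂ / fiberMass p W ω₁ else 0) :=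
        Finset.sum_le_sum fun ω₁ _ => Finset.sum_le_sum fun ω₂ _ => inner ω₁ ω₂
    _ = ∑ ω₁, p ω₁ * (fiberMass p W ω₁ / fiberMass p W ω₁) := by
        refine Finset.sum_congr rfl fun ω₁ _ => ?_
        nth_rewrite 2 [fiberMass]
        rw [Finset.sum_div, Finset.mul_sum]
        refine Finset.sum_congr rfl fun ω₂ _ => ?_
        split_ifs <;> ring
    _ ≤ ∑ ω, p ω :=
        Finset.sum_le_sum fun ω _ => mul_le_of_le_one_right (hp ω) (div_self_le_one _)

lemma ent_add_ent_le {E F G K : Type*} [Fintype E] [Fintype F] [Fintype G] [Fintype K]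
    (hp : ∀ ω, 0 ≤ p ω) {T : Ω → E} {U : Ω → F} {V : Ω → G} {W : Ω → K}
    (hT : ∀ ω ω', T ω = T ω' ↔ U ω = U ω' ∧ V ω = V ω')
    (hU : ∀ ω ω', U ω = U ω' → W ω = W ω') (hV : ∀ ω ω', V ω = V ω' → W ω = W ω') :
    ent p T + ent p W ≤ ent p U + ent p V := by
  have key : ∑ ω, p ω * (Real.log (fiberMass p U ω) + Real.log (fiberMass p V ω) -
      Real.log (fiberMass p T ω) - Real.log (fiberMass p W ω)) ≤ 0 := by
    calc _ ≤ ∑ ω, p ω * (fiberMass p U ω * fiberMass p V ω /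
          (fiberMass p T ω * fiberMass p W ω) - 1) := by
          refine Finset.sum_le_sum fun ω _ => ?_
          rcases (hp ω).eq_or_lt with h0 | h0
          · simp [← h0]
          have hu := h0.trans_le (le_fiberMass hp U ω)
          have hv := h0.trans_le (le_fiberMass hp V ω)
          have ht := h0.trans_le (le_fiberMass hp T ω)
          have hw := h0.trans_le (le_fiberMass hp W ω)
          refine mul_le_mul_of_nonneg_left (le_trans (le_of_eq ?_)
            (Real.log_le_sub_one_of_pos (by positivity))) (hp ω)
          rw [Real.log_div (by positivity) (by positivity), Real.log_mul hu.ne' hv.ne',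
            Real.log_mul ht.ne' hw.ne']
          ring
      _ ≤ 0 := by
          simpa [mul_sub] using sum_fiberMass_ratio_le hp hT hU hV
  have h2 : 0 < Real.log 2 := Real.log_pos one_lt_two
  have expand : ent p T + ent p W - (ent p U + ent p V) =
      (∑ ω, p ω * (Real.log (fiberMass p U ω) + Real.log (fiberMass p V ω) -
      Real.log (fiberMass p T ω) - Real.log (fiberMass p W ω))) / Real.log 2 := by
    simp only [ent_eq_neg_sum_fiberMass, Real.logb, mul_add, mul_sub, Finset.sum_add_distrib,
      Finset.sum_sub_distrib, ← mul_div_assoc, ← Finset.sum_div]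
    ring
  linarith [expand.trans_le (div_nonpos_of_nonpos_of_nonneg key h2.le)]

end Entropy

section Submodular

variable {ι : Type*} [LinearOrder ι] [LocallyFiniteOrderBot ι] {f : Finset ι → ℝ}

lemma sum_increments_le_of_submodular (h0 : f ∅ = 0)
    (hf : ∀ A B, f (A ∪ B) + f (A ∩ B) ≤ f A + f B) (A : Finset ι) :
    ∑ i ∈ A, (f (Finset.Iic i) - f (Finset.Iio i)) ≤ f A := by
  induction A using Finset.induction_on_max with
  | empty => simp [h0]
  | insert a s hs ih =>
    rw [Finset.sum_insert fun h => (hs a h).false]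
    have hsub := hf (insert a s) (Finset.Iio a)
    have hunion : insert a s ∪ Finset.Iio a = Finset.Iic a := by
      ext x; simp only [Finset.mem_union, Finset.mem_insert, Finset.mem_Iio, Finset.mem_Iic]
      grind
    have hinter : insert a s ∩ Finset.Iio a = s := by
      ext x; simp only [Finset.mem_inter, Finset.mem_insert, Finset.mem_Iio]
      grind
    rw [hunion, hinter] at hsub
    linarith

lemma sum_increments_eq_of_isLowerSet (h0 : f ∅ = 0) (A : Finset ι)
    (hA : IsLowerSet (A : Set ι)) :
    ∑ i ∈ A, (f (Finset.Iic i) - f (Finset.Iio i)) = f A := by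
  induction A using Finset.induction_on_max with
  | empty => simp [h0]
  | insert a s hs ih =>
    have hmem : ∀ x, x < a → x ∈ s := fun x hx => by
      have := hA hx.le (by simp : a ∈ (↑(insert a s) : Set ι))
      simpa [hx.ne] using this
    have hIio : Finset.Iio a = s := by
      ext x; simp only [Finset.mem_Iio]; exact ⟨hmem x, hs x⟩
    have hIic : Finset.Iic a = insert a s := by
      rw [← hIio, Finset.Iio_insert]
    have hlow : IsLowerSet (s : Set ι) := by
      rw [← hIio, Finset.coe_Iio]; exact isLowerSet_Iio a
    rw [Finset.sum_insert fun h => (hs a h).false, ih hlow, hIic, hIio]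
    ring

lemma Multiset.sum_map_sum_eq_sum_countP_mul {ι : Type*} [Fintype ι] [DecidableEq ι]
    (d : ι → ℝ) (𝒜 : Multiset (Finset ι)) :
    (𝒜.map fun A => ∑ i ∈ A, d i).sum = ∑ i, (𝒜.countP fun A => i ∈ A) * d i := by
  induction 𝒜 using Multiset.induction_on with
  | empty => simp
  | cons A 𝒜 ih =>
    simp [ih, Multiset.countP_cons, add_mul, Finset.sum_add_distrib, add_comm]

/-- Shearer's inequality for monotone submodular set functions. -/
lemma mul_le_sum_of_submodular [Fintype ι] (h0 : f ∅ = 0) (hmono : Monotone f)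
    (hf : ∀ A B, f (A ∪ B) + f (A ∩ B) ≤ f A + f B) (𝒜 : Multiset (Finset ι)) (m : ℕ)
    (hcov : ∀ i, m ≤ 𝒜.countP fun A => i ∈ A) :
    m * f Finset.univ ≤ (𝒜.map f).sum := by
  calc _ = ∑ i, m * (f (Finset.Iic i) - f (Finset.Iio i)) := by
        rw [← Finset.mul_sum, sum_increments_eq_of_isLowerSet h0 _ (by simp [isLowerSet_univ])]
    _ ≤ ∑ i, (𝒜.countP fun A => i ∈ A) * (f (Finset.Iic i) - f (Finset.Iio i)) :=
        Finset.sum_le_sum fun i _ => mul_le_mul_of_nonneg_right (by exact_mod_cast hcov i)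
          (sub_nonneg.2 (hmono Finset.Iio_subset_Iic_self))
    _ = (𝒜.map fun A => ∑ i ∈ A, (f (Finset.Iic i) - f (Finset.Iio i))).sum :=
        (Multiset.sum_map_sum_eq_sum_countP_mul _ 𝒜).symm
    _ ≤ _ := Multiset.sum_map_le_sum_map _ _ fun A _ => sum_increments_le_of_submodular h0 hf A

end Submodular

theorem shearer_lemma (Ω : Type*) [Fintype Ω] (p : Ω → ℝ)
    (hp0 : ∀ ω, 0 ≤ p ω) (hp1 : ∑ ω, p ω = 1)
    (n : ℕ) (E : Fin n → Type*) [∀ i, Fintype (E i)]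
    (X : ∀ i : Fin n, Ω → E i)
    (𝒜 : Multiset (Finset (Fin n))) (m : ℕ) (hm : 1 ≤ m)
    (hcov : ∀ i : Fin n, m ≤ 𝒜.countP (fun A => i ∈ A)) :
    ent p (fun ω => (fun i : Fin n => X i ω)) ≤
      (1 / (m : ℝ)) *
        (𝒜.map (fun A => ent p (fun ω => (fun i : {j // j ∈ A} => X i.1 ω)))).sum := by
  have hm' : (0 : ℝ) < m := by exact_mod_cast hm
  have agree (A : Finset (Fin n)) (ω ω' : Ω) :
      ((fun i : {j // j ∈ A} => X i.1 ω) = fun i : {j // j ∈ A} => X i.1 ω') ↔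
        ∀ i ∈ A, X i ω = X i ω' := by
    simp [funext_iff]
  have huniv : ent p (fun ω => (fun i : Fin n => X i ω)) =
      ent p (fun ω => (fun i : {j // j ∈ (Finset.univ : Finset (Fin n))} => X i.1 ω)) :=
    ent_congr fun ω ω' => by simp [funext_iff]
  rw [huniv, one_div_mul_eq_div, le_div_iff₀' hm']
  refine mul_le_sum_of_submodular
    (f := fun A => ent p (fun ω => (fun i : {j // j ∈ A} => X i.1 ω))) ?_ ?_ ?_ 𝒜 m ?_
  · exact ent_eq_zero_of_const hp1 fun ω ω' => by simp [agree]
  · intro A B hAB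
    refine ent_mono hp0 fun ω ω' h => ?_
    rw [agree] at h ⊢
    exact fun i hi => h i (hAB hi)
  · intro A B
    refine ent_add_ent_le hp0 (fun ω ω' => ?_) (fun ω ω' h => ?_) (fun ω ω' h => ?_)
    · simp only [agree, Finset.mem_union]
      exact ⟨fun h => ⟨fun i hi => h i (.inl hi), fun i hi => h i (.inr hi)⟩,
        fun h i hi => hi.elim (h.1 i) (h.2 i)⟩
    · rw [agree] at h ⊢
      exact fun i hi => h i (Finset.mem_of_mem_inter_left hi)
    · rw [agree] at h ⊢
      exact fun i hi => h i (Finset.mem_of_mem_inter_right hi)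
  · exact hcov
end

section
/- For n ≥ 2, the number of maximal independent sets of the hypercube graph Q_n satisfies mis(Q_n) ≥ 2^{2^{n-2}}. -/
/-- The hypercube graph `Q_n`: vertices are `0`-`1` strings of length `n`, two vertices being
adjacent iff they differ in exactly one coordinate. -/
def hypercubeGraph (n : ℕ) : SimpleGraph (Fin n → Bool) :=
  SimpleGraph.fromRel (fun x y => (Finset.univ.filter fun i => x i ≠ y i).card = 1)

/-- An induced matching `a` indexed by `ι` yields at least `2 ^ |ι|` maximal independent sets:
every choice of one endpoint per edge extends to a maximal independent set, and distinct choices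
have distinct extensions. -/
theorem two_pow_card_le_mis {V ι : Type*} [Finite V] [Fintype ι] (G : SimpleGraph V)
    (a : ι → Bool → V) (adj : ∀ i, G.Adj (a i false) (a i true))
    (ind : ∀ i j b c, G.Adj (a i b) (a j c) → i = j) :
    2 ^ Fintype.card ι ≤ mis G := by
  classical
  have extend (f : ι → Bool) : ∃ I : Set V, Set.range (fun i => a i (f i)) ⊆ I ∧
      Maximal (fun s : Set V => s.Pairwise fun x y => ¬ G.Adj x y) I := by
    refine Finite.exists_le_maximal (p := fun s : Set V => s.Pairwise fun x y => ¬ G.Adj x y) ?_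
    rintro _ ⟨i, rfl⟩ _ ⟨j, rfl⟩ - h
    obtain rfl := ind _ _ _ _ h
    exact G.irrefl h
  choose F hsub hmax using extend
  have hinj : Function.Injective F := by
    intro f g hfg
    funext i
    by_contra hne
    have hf : a i (f i) ∈ F f := hsub f ⟨i, rfl⟩
    have hg : a i (g i) ∈ F f := hfg ▸ hsub g ⟨i, rfl⟩
    have hadj : G.Adj (a i (f i)) (a i (g i)) := by
      have h := adj i
      cases hfi : f i <;> cases hgi : g i <;> simp_all [G.adj_comm]
    exact (hmax f).prop hf hg hadj.ne hadj
  calc 2 ^ Fintype.card ι = (Set.range F).ncard := by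
        rw [← Set.image_univ, Set.ncard_image_of_injective _ hinj, Set.ncard_univ]
        simp
    _ ≤ mis G := Set.ncard_le_ncard (Set.range_subset_iff.2 hmax) (Set.toFinite _)

theorem hypercubeGraph_adj {n : ℕ} {x y : Fin n → Bool} :
    (hypercubeGraph n).Adj x y ↔ ∃ i, ∀ j, x j ≠ y j ↔ j = i := by
  have key (x y : Fin n → Bool) : (Finset.univ.filter fun i => x i ≠ y i).card = 1 ↔
      ∃ i, ∀ j, x j ≠ y j ↔ j = i := by
    simp [Finset.card_eq_one, Finset.ext_iff]
  rw [hypercubeGraph, SimpleGraph.fromRel_adj, key, key]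
  constructor
  · rintro ⟨-, h | ⟨i, hi⟩⟩
    · exact h
    · exact ⟨i, fun j => ne_comm.trans (hi j)⟩
  · rintro ⟨i, hi⟩
    exact ⟨fun h => (hi i).2 rfl (congrFun h i), Or.inl ⟨i, hi⟩⟩

/-- The parity of the number of ones in a `0`-`1` string. -/
def parity {n : ℕ} (x : Fin n → Bool) : ZMod 2 :=
  ∑ i, if x i then 1 else 0

theorem parity_cons {n : ℕ} (b : Bool) (x : Fin n → Bool) :
    parity (Fin.cons b x : Fin (n + 1) → Bool) = (if b then 1 else 0) + parity x := by
  simp only [parity, Fin.sum_univ_succ, Fin.cons_zero, Fin.cons_succ]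

theorem parity_ne_of_adj {n : ℕ} {x y : Fin n → Bool} (h : (hypercubeGraph n).Adj x y) :
    parity x ≠ parity y := by
  obtain ⟨i, hi⟩ := hypercubeGraph_adj.1 h
  have hsum : parity x + parity y = 1 := by
    rw [parity, parity, ← Finset.sum_add_distrib, Finset.sum_eq_single i]
    · have := (hi i).2 rfl
      cases hx : x i <;> cases hy : y i <;> simp_all
    · intro j _ hj
      have : x j = y j := not_not.1 (mt (hi j).1 hj)
      rw [this]
      exact CharTwo.add_self_eq_zero _
    · simp
  intro heq
  rw [heq, CharTwo.add_self_eq_zero] at hsum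
  exact zero_ne_one hsum

/-- The endpoint, in direction `b`, of the matching edge of `Q_{m+2}` indexed by `x`. -/
def matchingVertex {m : ℕ} (x : Fin m → Bool) (b : Bool) : Fin (m + 2) → Bool :=
  Fin.cons b (Fin.cons (decide (parity x = 1)) x : Fin (m + 1) → Bool)

theorem parity_matchingVertex {m : ℕ} (x : Fin m → Bool) (b : Bool) :
    parity (matchingVertex x b) = if b then 1 else 0 := by
  rw [matchingVertex, parity_cons, parity_cons]
  generalize parity x = p
  revert p b
  decide

theorem matchingVertex_adj {m : ℕ} (x : Fin m → Bool) :
    (hypercubeGraph (m + 2)).Adj (matchingVertex x false) (matchingVertex x true) := by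
  refine hypercubeGraph_adj.2 ⟨0, fun j => ?_⟩
  cases j using Fin.cases <;> simp [matchingVertex]

theorem eq_of_matchingVertex_adj {m : ℕ} (x y : Fin m → Bool) (b c : Bool)
    (h : (hypercubeGraph (m + 2)).Adj (matchingVertex x b) (matchingVertex y c)) : x = y := by
  have hbc : b ≠ c := by
    rintro rfl
    exact parity_ne_of_adj h (by rw [parity_matchingVertex, parity_matchingVertex])
  obtain ⟨i, hi⟩ := hypercubeGraph_adj.1 h
  obtain rfl : 0 = i := (hi 0).1 hbc
  funext j
  exact not_not.1 (mt (hi j.succ.succ).1 (Fin.succ_ne_zero _))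

theorem mis_hypercube_lower_bound (n : ℕ) (hn : 2 ≤ n) :
    2 ^ 2 ^ (n - 2) ≤ mis (hypercubeGraph n) := by
  obtain ⟨m, rfl⟩ := Nat.exists_eq_add_of_le' hn
  simpa using two_pow_card_le_mis _ matchingVertex matchingVertex_adj
    (eq_of_matchingVertex_adj (m := m))
end

section
/- For n ≥ 1 and 0 ≤ k ≤ n-1, the number of maximal independent sets of B_{n,k} satisfies mis(B_{n,k}) ≥ 2^{binomial(n-1,k)}. -/
/-- The weight (number of ones) of a `0`-`1` string. -/
def wt {n : ℕ} (x : Fin n → Bool) : ℕ := (Finset.univ.filter fun i => x i = true).card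

/-- `B_{n,k}`: the subgraph of `Q_n` induced on the strings of weight `k` or `k+1`. -/
def middleLayersGraph (n k : ℕ) : SimpleGraph {x : Fin n → Bool | wt x = k ∨ wt x = k + 1} :=
  (hypercubeGraph n).induce {x : Fin n → Bool | wt x = k ∨ wt x = k + 1}

/-- In a finite graph, an induced matching indexed by `ι` yields `2 ^ |ι|` maximal independent
sets. -/
theorem two_pow_card_le_mis_of_induced_matching {V ι : Type*} [Finite V] [Fintype ι]
    (G : SimpleGraph V) (a b : ι → V) (hab : ∀ i, G.Adj (a i) (b i))
    (hab' : ∀ i j, G.Adj (a i) (b j) → i = j)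
    (ha : ∀ i j, ¬ G.Adj (a i) (a j)) (hb : ∀ i j, ¬ G.Adj (b i) (b j)) :
    2 ^ Fintype.card ι ≤ mis G := by
  classical
  let P : Set V → Prop := fun s => s.Pairwise fun a b => ¬ G.Adj a b
  let T : Set ι → Set V := fun S => a '' S ∪ b '' Sᶜ
  have hT : ∀ S, P (T S) := by
    rintro S _ (⟨i, hi, rfl⟩ | ⟨i, hi, rfl⟩) _ (⟨j, hj, rfl⟩ | ⟨j, hj, rfl⟩) - h
    · exact ha i j h
    · exact hj (hab' i j h ▸ hi)
    · exact hi (hab' j i h.symm ▸ hj)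
    · exact hb i j h
  have hex : ∀ S, ∃ I, T S ⊆ I ∧ Maximal P I := fun S =>
    (Set.toFinite {s | P s}).exists_le_maximal (hT S)
  choose F hTF hF using hex
  have mem_iff : ∀ S i, a i ∈ F S ↔ i ∈ S := by
    refine fun S i => ⟨fun h => ?_, fun h => hTF S (Or.inl ⟨i, h, rfl⟩)⟩
    by_contra hi
    exact (hF S).prop h (hTF S (Or.inr ⟨i, hi, rfl⟩)) (hab i).ne (hab i)
  have hinj : Function.Injective F := by
    intro S S' h
    ext i
    rw [← mem_iff S i, h, mem_iff]
  calc 2 ^ Fintype.card ι = (Set.univ : Set (Set ι)).ncard := by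
        rw [Set.ncard_univ, Nat.card_eq_fintype_card, Fintype.card_set]
    _ ≤ mis G := Set.ncard_le_ncard_of_injOn F (fun S _ => hF S) hinj.injOn (Set.toFinite _)

theorem hypercubeGraph_adj_iff {n : ℕ} {x y : Fin n → Bool} :
    (hypercubeGraph n).Adj x y ↔ ∃ j, ∀ i, x i ≠ y i ↔ i = j := by
  have key : ∀ x y : Fin n → Bool,
      (Finset.univ.filter fun i => x i ≠ y i).card = 1 ↔ ∃ j, ∀ i, x i ≠ y i ↔ i = j := by
    intro x y
    simp [Finset.card_eq_one, Finset.ext_iff]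
  rw [hypercubeGraph, SimpleGraph.fromRel_adj, key, key]
  constructor
  · rintro ⟨-, h | ⟨j, h⟩⟩
    · exact h
    · exact ⟨j, fun i => ne_comm.trans (h i)⟩
  · rintro ⟨j, h⟩
    exact ⟨fun hxy => (h j).2 rfl (congrFun hxy j), Or.inl ⟨j, h⟩⟩

theorem wt_ne_of_hypercubeGraph_adj {n : ℕ} {x y : Fin n → Bool}
    (h : (hypercubeGraph n).Adj x y) : wt x ≠ wt y := by
  obtain ⟨j, hj⟩ := hypercubeGraph_adj_iff.1 h
  wlog hx : x j = true generalizing x y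
  · refine (this h.symm (fun i => ne_comm.trans (hj i)) ?_).symm
    have := (hj j).2 rfl
    grind
  · refine (Finset.card_lt_card (Finset.ssubset_iff_subset_ne.2 ⟨fun i hi => ?_, fun he => ?_⟩)).ne'
    · have := hj i
      grind
    · have := Finset.ext_iff.1 he j
      have := (hj j).2 rfl
      grind

theorem wt_decide_mem {n : ℕ} (s : Finset (Fin n)) : wt (fun i => decide (i ∈ s)) = s.card := by
  simp [wt]

theorem mis_middleLayers_lower_bound (n k : ℕ) (hn : 1 ≤ n) (hk : k ≤ n - 1) :
    2 ^ ((n - 1).choose k) ≤ mis (middleLayersGraph n k) := by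
  let o : Fin n := ⟨0, hn⟩
  let A : Finset (Finset (Fin n)) := (Finset.univ.erase o).powersetCard k
  have ho : ∀ s : A, o ∉ s.1 := fun s h =>
    Finset.notMem_erase o _ ((Finset.mem_powersetCard.1 s.2).1 h)
  have hcard : ∀ s : A, s.1.card = k := fun s => (Finset.mem_powersetCard.1 s.2).2
  have hwa : ∀ s : A, wt (fun i => decide (i ∈ s.1)) = k := fun s => by
    rw [wt_decide_mem, hcard]
  have hwb : ∀ s : A, wt (fun i => decide (i ∈ insert o s.1)) = k + 1 := fun s => by
    rw [wt_decide_mem, Finset.card_insert_of_notMem (ho s), hcard]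
  have hA : Fintype.card A = (n - 1).choose k := by
    simp [A, Fintype.card_coe, -Finset.mem_powersetCard]
  rw [← hA]
  refine two_pow_card_le_mis_of_induced_matching (middleLayersGraph n k)
    (fun s => ⟨_, Or.inl (hwa s)⟩) (fun s => ⟨_, Or.inr (hwb s)⟩) ?_ ?_ ?_ ?_
  · intro s
    refine hypercubeGraph_adj_iff.2 ⟨o, fun i => ?_⟩
    simp only [ne_eq, decide_eq_decide, Function.Embedding.subtype_apply]
    have := ho s
    grind
  · intro s t h
    obtain ⟨j, hj⟩ := hypercubeGraph_adj_iff.1 h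
    simp only [ne_eq, decide_eq_decide, Function.Embedding.subtype_apply] at hj
    have hs := ho s
    have ht := ho t
    have := hj o
    ext i
    have := hj i
    grind
  · exact fun s t h => wt_ne_of_hypercubeGraph_adj h ((hwa s).trans (hwa t).symm)
  · exact fun s t h => wt_ne_of_hypercubeGraph_adj h ((hwb s).trans (hwb t).symm)
end

section
/- If M is an induced matching in a finite graph G, then mis(G) ≥ 2^{|M|}. -/
theorem mis_ge_two_pow_of_inducedMatching (V : Type*) [Fintype V] (G : SimpleGraph V)
    (M : Set (Sym2 V)) (hM : M ⊆ G.edgeSet)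
    (hind : ∀ e ∈ M, ∀ f ∈ M, e ≠ f → ∀ u v : V, u ∈ e → v ∈ f → u ≠ v ∧ ¬ G.Adj u v) :
    2 ^ M.ncard ≤ mis G := by
  classical
  have hends : ∀ e : Sym2 V, ∃ x y : V, s(x, y) = e :=
    fun e => Sym2.ind (fun x y => ⟨x, y, rfl⟩) e
  choose a b hab using hends
  have ha : ∀ e, a e ∈ e := fun e => by
    have := Sym2.mem_mk_left (a e) (b e)
    rwa [hab] at this
  have hb : ∀ e, b e ∈ e := fun e => by
    have := Sym2.mem_mk_right (a e) (b e)
    rwa [hab] at this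
  have hadj : ∀ e ∈ M, G.Adj (a e) (b e) := fun e he => by
    rw [← SimpleGraph.mem_edgeSet, hab]
    exact hM he
  rw [← Set.ncard_powerset M, mis]
  -- An independent set selects the edges of `M` whose first endpoint it contains.
  let φ : Set V → Set (Sym2 V) := fun I => {e ∈ M | a e ∈ I}
  refine (Set.ncard_le_ncard (t := φ '' _) ?_ (Set.toFinite _)).trans
    (Set.ncard_image_le (Set.toFinite _))
  intro S hS
  let c : Sym2 V → V := fun e => if e ∈ S then a e else b e
  have hc : ∀ e, c e ∈ e := fun e => by
    by_cases h : e ∈ S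
    · simpa [c, h] using ha e
    · simpa [c, h] using hb e
  have hT : (c '' M).Pairwise fun a b => ¬ G.Adj a b := by
    rintro _ ⟨e, he, rfl⟩ _ ⟨f, hf, rfl⟩ hne
    exact (hind e he f hf (fun h => hne (congrArg c h)) _ _ (hc e) (hc f)).2
  obtain ⟨I, hTI, hI⟩ := (Set.toFinite
    {s : Set V | s.Pairwise fun a b => ¬ G.Adj a b}).exists_le_maximal hT
  refine ⟨I, hI, Set.ext fun e => ⟨fun ⟨he, hae⟩ => ?_, fun he => ⟨hS he, ?_⟩⟩⟩
  · by_contra h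
    have hbe : b e ∈ I := hTI ⟨e, he, if_neg h⟩
    exact hI.prop hae hbe (hadj e he).ne (hadj e he)
  · exact hTI ⟨e, hS he, if_pos he⟩
end

section
/- Sapozhenko's lemma for maximal independent sets: let G be a graph on n vertices, b > 0 a real number, and I a maximal independent set of G. Then there exists S ⊆ I with |S| ≤ n/b such that, setting Y = V(G) ∖ (S ∪ N(S)) and Z = {y ∈ Y : |N(y) ∩ Y| < b}, one has: (i) every vertex of Z has fewer than b neighbors in Z, and (ii) I ∩ Z is a maximal independent set of the subgraph of G induced on Z. -/
/-- Every vertex outside a maximal independent set has a neighbor in it. -/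
theorem exists_adj_of_maximal_independent {V : Type*} {G : SimpleGraph V} {I : Set V}
    (hI : Maximal (fun s : Set V => s.Pairwise fun a b => ¬ G.Adj a b) I) {z : V} (hz : z ∉ I) :
    ∃ u ∈ I, G.Adj u z := by
  by_contra! h
  refine hz (hI.le_of_ge (y := insert z I) ?_ (Set.subset_insert z I) (Set.mem_insert z I))
  exact hI.prop.insert fun u hu _ => ⟨fun hzu => h u hu hzu.symm, h u hu⟩

/-- In a finite graph, every set `I` contains a subset `S` whose neighborhood has size at least
`b * |S|`, and such that every vertex of `I \ S` has fewer than `b` neighbors outside `N(S)`. -/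
theorem exists_subset_expanding_maximal {V : Type*} [Finite V] (G : SimpleGraph V) (b : ℝ)
    (I : Set V) :
    ∃ S ⊆ I, b * (S.ncard : ℝ) ≤ ((⋃ v ∈ S, G.neighborSet v).ncard : ℝ) ∧
      ∀ v ∈ I, v ∉ S → ((G.neighborSet v \ ⋃ u ∈ S, G.neighborSet u).ncard : ℝ) < b := by
  obtain ⟨S, hS⟩ := (Set.toFinite {S : Set V | S ⊆ I ∧
    b * (S.ncard : ℝ) ≤ ((⋃ v ∈ S, G.neighborSet v).ncard : ℝ)}).exists_maximal
      ⟨∅, by simp⟩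
  refine ⟨S, hS.prop.1, hS.prop.2, fun v hvI hvS => ?_⟩
  by_contra! hv
  refine hvS (hS.le_of_ge (y := insert v S) ⟨Set.insert_subset hvI hS.prop.1, ?_⟩
    (Set.subset_insert v S) (Set.mem_insert v S))
  have hcard := Set.ncard_sdiff_add_ncard (G.neighborSet v) (⋃ u ∈ S, G.neighborSet u)
  rw [Set.biUnion_insert, Set.ncard_insert_of_notMem hvS, ← hcard]
  push_cast
  linarith [hS.prop.2]

theorem sapozhenko_lemma (V : Type*) [Fintype V] (G : SimpleGraph V) (b : ℝ) (hb : 0 < b)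
    (I : Set V)
    (hI : Maximal (fun s : Set V => s.Pairwise fun a b => ¬ G.Adj a b) I) :
    ∃ S : Set V, S ⊆ I ∧ (S.ncard : ℝ) ≤ (Fintype.card V : ℝ) / b ∧
      ∀ Y Z : Set V,
        Y = (S ∪ ⋃ v ∈ S, G.neighborSet v)ᶜ →
        Z = {y ∈ Y | ((G.neighborSet y ∩ Y).ncard : ℝ) < b} →
        (∀ z ∈ Z, ((G.neighborSet z ∩ Z).ncard : ℝ) < b) ∧
          Maximal (fun T : Set V => T ⊆ Z ∧ T.Pairwise fun a b => ¬ G.Adj a b) (I ∩ Z) := by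
  obtain ⟨S, hSI, hcard, hdeg⟩ := exists_subset_expanding_maximal G b I
  refine ⟨S, hSI, ?_, fun Y Z hY hZ => ?_⟩
  · rw [le_div_iff₀ hb, mul_comm, ← Nat.card_eq_fintype_card]
    exact hcard.trans (by exact_mod_cast Set.ncard_le_card _)
  have hZY : Z ⊆ Y := hZ ▸ Set.sep_subset _ _
  have hYS : ∀ y ∈ Y, y ∉ S ∧ ∀ v ∈ S, ¬ G.Adj v y := by
    intro y hy
    simpa [hY, not_or] using hy
  have hdiff : ∀ v ∈ I, v ∉ S → v ∈ Z := by
    intro v hvI hvS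
    rw [hZ]
    constructor
    · simp only [hY, Set.mem_compl_iff, Set.mem_union, Set.mem_iUnion,
        SimpleGraph.mem_neighborSet, not_or, not_exists]
      exact ⟨hvS, fun u hu => hI.prop (hSI hu) hvI fun h => hvS (h ▸ hu)⟩
    · refine lt_of_le_of_lt ?_ (hdeg v hvI hvS)
      refine Nat.cast_le.mpr (Set.ncard_le_ncard fun y hy => ⟨hy.1, ?_⟩)
      simpa using (hYS y hy.2).2
  refine ⟨fun z hz => ?_, ⟨Set.inter_subset_right, hI.prop.mono Set.inter_subset_left⟩,
    fun T hT hIT z hzT => ?_⟩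
  · have hz' := hz
    rw [hZ] at hz'
    exact lt_of_le_of_lt
      (Nat.cast_le.mpr (Set.ncard_le_ncard (Set.inter_subset_inter_right _ hZY))) hz'.2
  · have hzZ := hT.1 hzT
    refine ⟨?_, hzZ⟩
    by_contra hzI
    obtain ⟨u, huI, huz⟩ := exists_adj_of_maximal_independent hI hzI
    have huS : u ∉ S := fun hu => (hYS z (hZY hzZ)).2 u hu huz
    exact hT.2 (hIT ⟨huI, hdiff u huI huS⟩) hzT huz.ne huz
end

section
/- If Z is a convex subset of the Boolean lattice B_n, then the number of maximal antichains of the restriction of B_n to Z satisfies ma(Z) ≤ 2^{|Z|/2}, i.e. ma(Z)² ≤ 2^{|Z|}. -/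
/-- The number of maximal antichains of the restriction of the Boolean lattice `B_n` to a
subset `Z`: antichains contained in `Z` that are maximal among antichains contained in `Z`. -/
noncomputable def maOn {n : ℕ} (Z : Set (Finset (Fin n))) : ℕ :=
  {A : Set (Finset (Fin n)) |
    Maximal (fun s => s ⊆ Z ∧ IsAntichain (· ⊆ ·) s) A}.ncard

open Finset Classical in
/-- The finset of maximal antichains of the restriction of a partial order to `Z`. -/
noncomputable def maximalAntichains {α : Type*} [PartialOrder α] (Z : Finset α) :
    Finset (Finset α) :=
  {A ∈ Z.powerset | (∀ a ∈ A, ∀ b ∈ A, a ≤ b → a = b) ∧ ∀ z ∈ Z, ∃ a ∈ A, a ≤ z ∨ z ≤ a}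

/-- `v` is a minimal or a maximal element relative to `Z`. -/
def IsExtremal {α : Type*} [PartialOrder α] (Z : Finset α) (v : α) : Prop :=
  (∀ w ∈ Z, w ≤ v → w = v) ∨ ∀ w ∈ Z, v ≤ w → w = v

open Classical in
/-- The elements of `Z` comparable to `v`. -/
noncomputable def comparables {α : Type*} [PartialOrder α] (Z : Finset α) (v : α) : Finset α :=
  {w ∈ Z | w ≤ v ∨ v ≤ w}

section

open Finset Classical

variable {α : Type*} [PartialOrder α] {Z A : Finset α} {v w x y z : α}

theorem mem_maximalAntichains : A ∈ maximalAntichains Z ↔ A ⊆ Z ∧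
    (∀ a ∈ A, ∀ b ∈ A, a ≤ b → a = b) ∧ ∀ z ∈ Z, ∃ a ∈ A, a ≤ z ∨ z ≤ a := by
  simp [maximalAntichains]

theorem mem_comparables : w ∈ comparables Z v ↔ w ∈ Z ∧ (w ≤ v ∨ v ≤ w) := by
  simp [comparables]

theorem comparables_subset : comparables Z v ⊆ Z := filter_subset _ _

theorem erase_mem_maximalAntichains (hA : A ∈ maximalAntichains Z) (hv : v ∈ A) :
    A.erase v ∈ maximalAntichains (Z \ comparables Z v) := by
  simp only [mem_maximalAntichains, mem_comparables, mem_sdiff, mem_erase, subset_iff] at *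
  grind

theorem card_filter_mem_maximalAntichains_le :
    #{A ∈ maximalAntichains Z | v ∈ A} ≤ #(maximalAntichains (Z \ comparables Z v)) := by
  refine card_le_card_of_injOn (fun A => A.erase v) ?_ ?_
  · intro A hA
    rw [mem_coe, mem_filter] at hA
    exact erase_mem_maximalAntichains hA.1 hA.2
  · intro A hA B hB h
    simp only [coe_filter, Set.mem_ofPred_eq] at hA hB
    rw [← insert_erase hA.2, ← insert_erase hB.2]
    exact congrArg (insert v) h

theorem card_filter_mem_mem_maximalAntichains_le (hvw : w ≠ v) :
    #{A ∈ maximalAntichains Z | v ∈ A ∧ w ∈ A} ≤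
      #(maximalAntichains ((Z \ comparables Z v) \ comparables (Z \ comparables Z v) w)) := by
  refine le_trans (card_le_card_of_injOn (fun A => A.erase v) ?_ ?_)
    card_filter_mem_maximalAntichains_le
  · intro A hA
    rw [mem_coe, mem_filter] at hA ⊢
    exact ⟨erase_mem_maximalAntichains hA.1 hA.2.1, mem_erase.2 ⟨hvw, hA.2.2⟩⟩
  · intro A hA B hB h
    simp only [coe_filter, Set.mem_ofPred_eq] at hA hB
    rw [← insert_erase hA.2.1, ← insert_erase hB.2.1]
    exact congrArg (insert v) h

theorem card_filter_notMem_maximalAntichains_le :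
    #{A ∈ maximalAntichains Z | v ∉ A} ≤ #(maximalAntichains (Z.erase v)) := by
  refine card_le_card fun A hA => ?_
  simp only [mem_filter, mem_maximalAntichains, mem_erase, subset_iff] at *
  grind

theorem IsExtremal.ordConnected_erase (h : IsExtremal Z v) (hZ : (Z : Set α).OrdConnected) :
    (Z.erase v : Set α).OrdConnected := by
  refine ⟨fun a ha b hb c hc => ?_⟩
  simp only [coe_erase, Set.mem_sdiff, mem_coe, Set.mem_singleton_iff] at *
  have hcZ : c ∈ Z := hZ.out ha.1 hb.1 hc
  refine ⟨hcZ, ?_⟩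
  rintro rfl
  rcases h with h | h
  · exact ha.2 (h a ha.1 hc.1)
  · exact hb.2 (h b hb.1 hc.2)

theorem ordConnected_sdiff_comparables (hZ : (Z : Set α).OrdConnected) :
    ((Z \ comparables Z v : Finset α) : Set α).OrdConnected := by
  refine ⟨fun a ha b hb c hc => ?_⟩
  simp only [mem_coe, mem_sdiff, mem_comparables, not_and, not_or] at *
  have hcZ : c ∈ Z := hZ.out ha.1 hb.1 hc
  have ha' := ha.2 ha.1
  have hb' := hb.2 hb.1
  refine ⟨hcZ, fun _ => ⟨fun h1 => ha'.1 (hc.1.trans h1), fun h1 => hb'.2 (h1.trans hc.2)⟩⟩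

theorem not_lt_of_card_comparables_le_three
    (hα : ∀ x y z : α, x < y → y < z → ∃ y', y' ≠ y ∧ x < y' ∧ y' < z)
    (hZ : (Z : Set α).OrdConnected) (hx : x ∈ Z) (hz : z ∈ Z)
    (hv : v = x ∨ v = z) (hcard : #(comparables Z v) ≤ 3) (hxy : x < y) : ¬ y < z := by
  intro hyz
  obtain ⟨y', hne, h1, h2⟩ := hα x y z hxy hyz
  have hy : y ∈ Z := hZ.out hx hz ⟨hxy.le, hyz.le⟩
  have hy' : y' ∈ Z := hZ.out hx hz ⟨h1.le, h2.le⟩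
  have hsub : ({x, y, y', z} : Finset α) ⊆ comparables Z v := by
    intro w hw
    simp only [mem_insert, mem_singleton] at hw
    rw [mem_comparables]
    have := hxy.trans hyz
    rcases hv with rfl | rfl <;> rcases hw with rfl | rfl | rfl | rfl <;>
      simp [*, le_of_lt]
  have h4 : #({x, y, y', z} : Finset α) = 4 := by
    rw [card_insert_of_notMem, card_insert_of_notMem, card_pair h2.ne]
    · simp [hne.symm, hyz.ne]
    · simp [hxy.ne, h1.ne, (hxy.trans hyz).ne]
  have := card_le_card hsub
  omega

theorem isExtremal_of_mem_comparables
    (hα : ∀ x y z : α, x < y → y < z → ∃ y', y' ≠ y ∧ x < y' ∧ y' < z)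
    (hZ : (Z : Set α).OrdConnected) (hx : x ∈ Z)
    (hcard : #(comparables Z x) ≤ 3) (hy : y ∈ comparables Z x) (hyx : y ≠ x) :
    IsExtremal Z y := by
  rw [mem_comparables] at hy
  rcases hy.2 with h | h
  · left
    intro w hw hwy
    by_contra hne
    exact not_lt_of_card_comparables_le_three hα hZ hw hx (.inr rfl) hcard
      (lt_of_le_of_ne hwy hne) (lt_of_le_of_ne h hyx)
  · right
    intro w hw hwy
    by_contra hne
    exact not_lt_of_card_comparables_le_three hα hZ hx hw (.inl rfl) hcard
      (lt_of_le_of_ne h hyx.symm) (lt_of_le_of_ne hwy (Ne.symm hne))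

theorem IsExtremal.eq_of_le
    (hα : ∀ x y z : α, x < y → y < z → ∃ y', y' ≠ y ∧ x < y' ∧ y' < z)
    (hZ : (Z : Set α).OrdConnected) (hx : x ∈ Z) (hext : IsExtremal Z x)
    (hcard : #(comparables Z x) ≤ 3) (hy : y ∈ comparables Z x) (hyx : y ≠ x)
    (hz : z ∈ comparables Z x) (hzx : z ≠ x) (hyz : y ≤ z) : y = z := by
  rw [mem_comparables] at hy hz
  by_contra hne
  have hlt := lt_of_le_of_ne hyz hne
  rcases hext with h | h
  · have hxy : x < y := lt_of_le_of_ne (hy.2.resolve_left fun h' => hyx (h y hy.1 h')) hyx.symm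
    exact not_lt_of_card_comparables_le_three hα hZ hx hz.1 (.inl rfl) hcard hxy hlt
  · have hzx' : z < x := lt_of_le_of_ne (hz.2.resolve_right fun h' => hzx (h z hz.1 h')) hzx
    exact not_lt_of_card_comparables_le_three hα hZ hy.1 hx (.inr rfl) hcard hlt hzx'

theorem cast_le_sqrt_two_pow {a m k N : ℕ} (h : (a : ℝ) ≤ √2 ^ m) (hm : m + k ≤ N) :
    (a : ℝ) * √2 ^ k ≤ √2 ^ N := by
  have h1 : (1 : ℝ) ≤ √2 := Real.one_le_sqrt.2 (by norm_num)
  calc (a : ℝ) * √2 ^ k ≤ √2 ^ m * √2 ^ k := by gcongr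
    _ = √2 ^ (m + k) := (pow_add _ _ _).symm
    _ ≤ √2 ^ N := pow_le_pow_right₀ h1 hm

/-- In a partial order all of whose intervals of length two have at least two interior points,
a convex set `Z` has at most `√2 ^ #Z` maximal antichains. -/
theorem card_maximalAntichains_le
    (hα : ∀ x y z : α, x < y → y < z → ∃ y', y' ≠ y ∧ x < y' ∧ y' < z) (Z : Finset α)
    (hZ : (Z : Set α).OrdConnected) : (#(maximalAntichains Z) : ℝ) ≤ √2 ^ #Z := by
  induction Z using Finset.strongInduction with
  | H Z ih =>
  have hs : √2 ^ 2 = (2 : ℝ) := Real.sq_sqrt (by norm_num)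
  have hs1 : (1 : ℝ) ≤ √2 := Real.one_le_sqrt.2 (by norm_num)
  have hs32 : √2 ≤ (3 / 2 : ℝ) := Real.sqrt_le_iff.2 ⟨by norm_num, by norm_num⟩
  have hs3 : √2 ^ 3 = 2 * √2 := by rw [pow_succ, hs]
  have hs4 : √2 ^ 4 = (4 : ℝ) := by rw [pow_succ, hs3]; nlinarith
  have hself : ∀ {v}, v ∈ Z → v ∈ comparables Z v := fun hv => mem_comparables.2 ⟨hv, .inl le_rfl⟩
  have ih_mem : ∀ {v} (k : ℕ), v ∈ Z → k ≤ #(comparables Z v) →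
      (#{A ∈ maximalAntichains Z | v ∈ A} : ℝ) * √2 ^ k ≤ √2 ^ #Z := by
    intro v k hv hk
    refine cast_le_sqrt_two_pow (m := #(Z \ comparables Z v)) ?_ ?_
    · refine le_trans (by exact_mod_cast card_filter_mem_maximalAntichains_le)
        (ih _ (sdiff_ssubset comparables_subset ⟨v, hself hv⟩) (ordConnected_sdiff_comparables hZ))
    · have := card_sdiff_add_card_eq_card (comparables_subset (Z := Z) (v := v))
      omega
  have bound_of_four : ∀ {v}, v ∈ Z → IsExtremal Z v → 4 ≤ #(comparables Z v) →
      (#(maximalAntichains Z) : ℝ) ≤ √2 ^ #Z := by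
    intro v hv hext hk
    have h1 := ih_mem 4 hv hk
    have h2 : (#{A ∈ maximalAntichains Z | v ∉ A} : ℝ) * √2 ^ 1 ≤ √2 ^ #Z := by
      refine cast_le_sqrt_two_pow (m := #(Z.erase v)) ?_ (card_erase_add_one hv).le
      exact le_trans (by exact_mod_cast card_filter_notMem_maximalAntichains_le)
        (ih _ (erase_ssubset hv) (hext.ordConnected_erase hZ))
    have h3 : (#(maximalAntichains Z) : ℝ) = #{A ∈ maximalAntichains Z | v ∈ A} +
        #{A ∈ maximalAntichains Z | v ∉ A} := by
      exact_mod_cast (card_filter_add_card_filter_not (s := maximalAntichains Z) (v ∈ ·)).symm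
    rw [hs4] at h1
    rw [h3]
    nlinarith
  have bound_of_one : ∀ {v}, v ∈ Z → #(comparables Z v) = 1 →
      (#(maximalAntichains Z) : ℝ) ≤ √2 ^ #Z := by
    intro v hv hk
    have h1 := ih_mem 0 hv (Nat.zero_le _)
    have h2 : {A ∈ maximalAntichains Z | v ∈ A} = maximalAntichains Z := by
      refine filter_true_of_mem fun A hA => ?_
      rw [mem_maximalAntichains] at hA
      obtain ⟨a, ha, hav⟩ := hA.2.2 v hv
      rwa [← card_le_one.1 hk.le a (mem_comparables.2 ⟨hA.1 ha, hav⟩) v (hself hv)]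
    simpa [h2] using h1
  have bound_of_two : ∀ {v}, v ∈ Z → #(comparables Z v) = 2 →
      (#(maximalAntichains Z) : ℝ) ≤ √2 ^ #Z := by
    intro v hv hk
    obtain ⟨w, hw, hwv⟩ := exists_mem_ne (by omega : 1 < #(comparables Z v)) v
    have hwZ := comparables_subset hw
    have heq : {v, w} = comparables Z v := eq_of_subset_of_card_le
      (by simp [insert_subset_iff, hw, hself hv]) (by rw [card_pair hwv.symm, hk])
    have h1 := ih_mem 2 hv hk.ge
    have h2 := ih_mem 2 hwZ (by
      rw [← card_pair hwv]
      refine card_le_card ?_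
      rw [insert_subset_iff, singleton_subset_iff]
      exact ⟨hself hwZ, mem_comparables.2 ⟨hv, (mem_comparables.1 hw).2.symm⟩⟩)
    have h3 : #(maximalAntichains Z) ≤ #{A ∈ maximalAntichains Z | v ∈ A} +
        #{A ∈ maximalAntichains Z | w ∈ A} := by
      refine (card_le_card fun A hA => ?_).trans (card_union_le _ _)
      have hA' := mem_maximalAntichains.1 hA
      obtain ⟨a, ha, hav⟩ := hA'.2.2 v hv
      have : a ∈ ({v, w} : Finset α) := heq ▸ mem_comparables.2 ⟨hA'.1 ha, hav⟩
      simp only [mem_insert, mem_singleton] at this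
      rw [mem_union, mem_filter, mem_filter]
      rcases this with rfl | rfl <;> simp [hA, ha]
    have h3' : (#(maximalAntichains Z) : ℝ) ≤ #{A ∈ maximalAntichains Z | v ∈ A} +
        #{A ∈ maximalAntichains Z | w ∈ A} := by exact_mod_cast h3
    rw [hs] at h1 h2
    linarith
  have bound_of_ne_three : ∀ {v}, v ∈ Z → IsExtremal Z v → #(comparables Z v) ≠ 3 →
      (#(maximalAntichains Z) : ℝ) ≤ √2 ^ #Z := by
    intro v hv hext hk
    have hpos : 0 < #(comparables Z v) := card_pos.2 ⟨v, hself hv⟩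
    obtain h | h | h : #(comparables Z v) = 1 ∨ #(comparables Z v) = 2 ∨
      4 ≤ #(comparables Z v) := by omega
    exacts [bound_of_one hv h, bound_of_two hv h, bound_of_four hv hext h]
  rcases Z.eq_empty_or_nonempty with rfl | hne
  · simp [maximalAntichains, filter_singleton]
  obtain ⟨x, hx⟩ := exists_minimal hne
  have hxZ : x ∈ Z := hx.1
  have hxe : IsExtremal Z x := .inl fun w hw hwx => le_antisymm hwx (hx.2 hw hwx)
  by_cases hx3 : #(comparables Z x) = 3
  swap
  · exact bound_of_ne_three hxZ hxe hx3
  obtain ⟨y, hy, hyx⟩ := exists_mem_ne (by omega : 1 < #(comparables Z x)) x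
  have hyZ := comparables_subset hy
  have hye := isExtremal_of_mem_comparables hα hZ hxZ hx3.le hy hyx
  by_cases hy3 : #(comparables Z y) = 3
  swap
  · exact bound_of_ne_three hyZ hye hy3
  have third : ∀ {a b : α}, a ∈ Z → b ∈ comparables Z a → b ≠ a → #(comparables Z a) = 3 →
      ∃ c ∈ comparables Z a, c ≠ a ∧ c ≠ b ∧ comparables Z a = {a, b, c} := by
    intro a b ha hb hba h3
    have hlt : #({a, b} : Finset α) < #(comparables Z a) := by rw [card_pair hba.symm, h3]; simp
    obtain ⟨c, hc, hcn⟩ := exists_mem_notMem_of_card_lt_card hlt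
    simp only [mem_insert, mem_singleton, not_or] at hcn
    refine ⟨c, hc, hcn.1, hcn.2, (eq_of_subset_of_card_le ?_ ?_).symm⟩
    · simp [insert_subset_iff, hb, hc, hself ha]
    · rw [h3, card_eq_three.2 ⟨a, b, c, hba.symm, Ne.symm hcn.1, Ne.symm hcn.2, rfl⟩]
  have hxy : x ∈ comparables Z y := mem_comparables.2 ⟨hxZ, (mem_comparables.1 hy).2.symm⟩
  obtain ⟨z, hz, hzx, hzy, hxeq⟩ := third hxZ hy hyx hx3
  obtain ⟨u, hu, huy, hux, hyeq⟩ := third hyZ hxy hyx.symm hy3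
  have hzZ := comparables_subset hz
  have huZ := comparables_subset hu
  have huz : u ≠ z := by
    rintro rfl
    rcases (mem_comparables.1 hu).2 with h | h
    · exact huy (hxe.eq_of_le hα hZ hxZ hx3.le hz hzx hy hyx h)
    · exact huy (hxe.eq_of_le hα hZ hxZ hx3.le hy hyx hz hzx h).symm
  have h1 := ih_mem 3 hxZ hx3.ge
  have h2 := ih_mem 3 hyZ hy3.ge
  set Z₁ := Z \ comparables Z z with hZ₁
  have h3 : (#{A ∈ maximalAntichains Z | z ∈ A ∧ u ∈ A} : ℝ) * √2 ^ 4 ≤ √2 ^ #Z := by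
    have hsub : Z₁ \ comparables Z₁ u ⊆ Z := sdiff_subset.trans sdiff_subset
    have hdisj : Disjoint (Z₁ \ comparables Z₁ u) {x, y, z, u} := by
      rw [disjoint_right]
      intro a ha
      simp only [mem_insert, mem_singleton] at ha
      simp only [hZ₁, mem_sdiff, mem_comparables]
      have hxz := (mem_comparables.1 hz).2.symm
      have hyu := (mem_comparables.1 hu).2.symm
      rcases ha with rfl | rfl | rfl | rfl <;> simp <;> tauto
    have h4 : #({x, y, z, u} : Finset α) = 4 := by
      rw [card_insert_of_notMem, card_insert_of_notMem, card_pair huz.symm]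
      · simp [hzy.symm, huy.symm]
      · simp [hyx.symm, hzx.symm, hux.symm]
    have hcard : #(Z₁ \ comparables Z₁ u) + 4 ≤ #Z := by
      rw [← h4, ← card_union_of_disjoint hdisj]
      refine card_le_card (union_subset hsub ?_)
      simp [insert_subset_iff, hxZ, hyZ, hzZ, huZ]
    refine cast_le_sqrt_two_pow (m := #(Z₁ \ comparables Z₁ u)) ?_ hcard
    refine le_trans (by exact_mod_cast card_filter_mem_mem_maximalAntichains_le huz)
      (ih _ (ssubset_of_subset_of_ne hsub ?_) ?_)
    · intro h
      rw [h] at hcard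
      omega
    · exact ordConnected_sdiff_comparables (ordConnected_sdiff_comparables hZ)
  have h4 : #(maximalAntichains Z) ≤ #{A ∈ maximalAntichains Z | x ∈ A} +
      #{A ∈ maximalAntichains Z | y ∈ A} + #{A ∈ maximalAntichains Z | z ∈ A ∧ u ∈ A} := by
    refine (card_le_card fun A hA => ?_).trans
      ((card_union_le _ _).trans (Nat.add_le_add_right (card_union_le _ _) _))
    have hA' := mem_maximalAntichains.1 hA
    obtain ⟨a, ha, hax⟩ := hA'.2.2 x hxZ
    obtain ⟨b, hb, hby⟩ := hA'.2.2 y hyZ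
    have hax' : a ∈ ({x, y, z} : Finset α) := hxeq ▸ mem_comparables.2 ⟨hA'.1 ha, hax⟩
    have hby' : b ∈ ({y, x, u} : Finset α) := hyeq ▸ mem_comparables.2 ⟨hA'.1 hb, hby⟩
    simp only [mem_insert, mem_singleton] at hax' hby'
    simp only [mem_union, mem_filter]
    rcases hax' with rfl | rfl | rfl
    · simp [hA, ha]
    · simp [hA, ha]
    · rcases hby' with rfl | rfl | rfl <;> simp [hA, ha, hb]
  have h4' : (#(maximalAntichains Z) : ℝ) ≤ #{A ∈ maximalAntichains Z | x ∈ A} +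
      #{A ∈ maximalAntichains Z | y ∈ A} + #{A ∈ maximalAntichains Z | z ∈ A ∧ u ∈ A} := by
    exact_mod_cast h4
  rw [hs3] at h1 h2
  rw [hs4] at h3
  nlinarith

theorem Maximal.toFinset_mem_maximalAntichains {S A : Set α} {hA : A.Finite} {hS : S.Finite}
    (h : Maximal (fun s => s ⊆ S ∧ IsAntichain (· ≤ ·) s) A) :
    hA.toFinset ∈ maximalAntichains hS.toFinset := by
  rw [mem_maximalAntichains]
  simp only [Set.Finite.mem_toFinset, Set.Finite.toFinset_subset_toFinset]
  refine ⟨h.1.1, fun a ha b hb => h.1.2.eq ha hb, fun z hz => ?_⟩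
  by_contra! hcon
  have hzA : z ∈ A := h.2 (y := insert z A)
    ⟨Set.insert_subset hz h.1.1, h.1.2.insert (fun b hb _ => (hcon b hb).1)
      fun b hb _ => (hcon b hb).2⟩ (Set.subset_insert _ _) (Set.mem_insert _ _)
  exact (hcon z hzA).1 le_rfl

end

theorem Finset.exists_ne_between {α : Type*} [DecidableEq α] {x y z : Finset α}
    (hxy : x < y) (hyz : y < z) : ∃ y', y' ≠ y ∧ x < y' ∧ y' < z := by
  obtain ⟨a, ha, hax⟩ := Finset.exists_of_ssubset hxy
  obtain ⟨b, hb, hby⟩ := Finset.exists_of_ssubset hyz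
  have hbx : b ∉ x := fun h => hby (hxy.le h)
  refine ⟨x ∪ z \ y, fun h => hby (h ▸ by simp [hb, hby]), ?_, ?_⟩
  · exact Finset.ssubset_iff_of_subset Finset.subset_union_left |>.2 ⟨b, by simp [hb, hby], hbx⟩
  · refine Finset.ssubset_iff_of_subset
      (Finset.union_subset (hxy.le.trans hyz.le) Finset.sdiff_subset) |>.2 ⟨a, hyz.le ha, ?_⟩
    simp [ha, hax]

theorem maOn_le_of_convex {n : ℕ} (Z : Set (Finset (Fin n)))
    (hconv : ∀ x y z : Finset (Fin n), x ∈ Z → z ∈ Z → x ⊆ y → y ⊆ z → y ∈ Z) :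
    (maOn Z) ^ 2 ≤ 2 ^ Z.ncard := by
  have hle : maOn Z ≤ (maximalAntichains Z.toFinite.toFinset).card := by
    rw [maOn, ← Set.ncard_coe_finset]
    refine Set.ncard_le_ncard_of_injOn (fun A => A.toFinite.toFinset)
      (fun A hA => Maximal.toFinset_mem_maximalAntichains hA) fun A _ B _ h => ?_
    simpa using h
  have hcard := card_maximalAntichains_le (fun _ _ _ => Finset.exists_ne_between)
    Z.toFinite.toFinset ⟨fun x hx z hz y hy => by
      simp only [Set.Finite.coe_toFinset] at hx hz ⊢
      exact hconv x y z hx hz hy.1 hy.2⟩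
  rw [← Set.ncard_eq_toFinset_card Z] at hcard
  have hma : (maOn Z : ℝ) ≤ √2 ^ Z.ncard := le_trans (by exact_mod_cast hle) hcard
  have hsq : (maOn Z : ℝ) ^ 2 ≤ 2 ^ Z.ncard := by
    calc (maOn Z : ℝ) ^ 2 ≤ (√2 ^ Z.ncard) ^ 2 := by gcongr
      _ = 2 ^ Z.ncard := by rw [← pow_mul, mul_comm, pow_mul, Real.sq_sqrt (by norm_num)]
  exact_mod_cast hsq
end

section
/- Let n be large enough that 0.4n ≤ ⌊n/2⌋, let b > 0 be a real number with ε := 2.5b/n < 1, and let Z be a convex subset of the Boolean lattice B_n all of whose elements have size between 0.4n and 0.6n, such that every y ∈ Z is covered by fewer than b elements of Z. Then |Z| ≤ (1 − ε)^{-1} · binomial(n, ⌊n/2⌋). -/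
/-- `dplus Z y` is the number of elements of `Z` covering `y` in the Boolean lattice,
i.e. the number of `x ∈ Z` with `y ⊆ x` and `|x| = |y| + 1`. -/
noncomputable def dplus {n : ℕ} (Z : Set (Finset (Fin n))) (y : Finset (Fin n)) : ℕ :=
  {x ∈ Z | y ⊆ x ∧ x.card = y.card + 1}.ncard

open Finset in
/-- The expected number of members of `Z` on a uniformly random maximal chain from `y` up to
the full set. -/
noncomputable def chainWeight {α : Type*} [Fintype α] [DecidableEq α]
    (Z : Finset (Finset α)) (y : Finset α) : ℝ :=
  ∑ z ∈ Z with y ⊆ z, ((#yᶜ).choose #(z \ y) : ℝ)⁻¹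

section

open Finset

variable {α : Type*} [Fintype α] [DecidableEq α]

lemma chainWeight_univ_le_one (Z : Finset (Finset α)) : chainWeight Z univ ≤ 1 := by
  have h : (Z.filter fun z => (univ : Finset α) ⊆ z) ⊆ {univ} := fun z hz => by
    simpa using (mem_filter.1 hz).2
  calc chainWeight Z univ ≤ ∑ z ∈ {univ}, ((#(univ : Finset α)ᶜ).choose #(z \ univ) : ℝ)⁻¹ :=
        sum_le_sum_of_subset_of_nonneg h fun _ _ _ => by positivity
    _ = 1 := by simp

lemma inv_choose_eq_mul_inv_choose_pred (m k : ℕ) (hk : 0 < k) (hkm : k ≤ m) :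
    (m.choose k : ℝ)⁻¹ = k * ((m - 1).choose (k - 1) : ℝ)⁻¹ / m := by
  obtain ⟨k, rfl⟩ := Nat.exists_eq_succ_of_ne_zero hk.ne'
  obtain ⟨m, rfl⟩ := Nat.exists_eq_succ_of_ne_zero (by omega : m ≠ 0)
  have h := Nat.add_one_mul_choose_eq m k
  have h1 : (0 : ℝ) < m.choose k := by exact_mod_cast Nat.choose_pos (by omega)
  have h2 : (0 : ℝ) < (m + 1).choose (k + 1) := by exact_mod_cast Nat.choose_pos (by omega)
  have h' : ((m : ℝ) + 1) * m.choose k = (m + 1).choose (k + 1) * (k + 1) := by exact_mod_cast h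
  simp only [Nat.succ_eq_add_one, Nat.add_sub_cancel]
  push_cast
  field_simp
  linarith

/-- Conditioning a random maximal chain from `y` on its first step. -/
lemma chainWeight_eq_add_average (Z : Finset (Finset α)) (y : Finset α) :
    chainWeight Z y =
      (if y ∈ Z then 1 else 0) + (∑ i ∈ yᶜ, chainWeight Z (insert i y)) / #yᶜ := by
  have hswap : ∑ i ∈ yᶜ, chainWeight Z (insert i y) =
      ∑ z ∈ Z, if y ⊆ z then #(z \ y) * ((#yᶜ - 1).choose (#(z \ y) - 1) : ℝ)⁻¹ else 0 := by
    simp only [chainWeight, sum_filter]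
    rw [sum_comm]
    refine sum_congr rfl fun z _ => ?_
    split_ifs with hyz
    · rw [← sum_filter]
      have hfil : (yᶜ.filter fun i => insert i y ⊆ z) = z \ y := by
        ext i
        simp only [mem_filter, mem_compl, insert_subset_iff, mem_sdiff]
        tauto
      rw [hfil, ← nsmul_eq_mul]
      refine sum_eq_card_nsmul fun i hi => ?_
      have hiy : i ∈ yᶜ := mem_compl.2 (mem_sdiff.1 hi).2
      rw [compl_insert, card_erase_of_mem hiy, sdiff_insert, card_erase_of_mem hi]
    · exact sum_eq_zero fun i _ =>
        if_neg fun h => hyz ((subset_insert i y).trans h)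
  have hite : (if y ∈ Z then (1 : ℝ) else 0) = ∑ z ∈ Z, if y = z then 1 else 0 := by simp
  rw [hswap, sum_div, hite, ← sum_add_distrib, chainWeight, sum_filter]
  refine sum_congr rfl fun z _ => ?_
  by_cases hyz : y ⊆ z
  · rcases eq_or_ne y z with rfl | hne
    · simp
    · have hpos : 0 < #(z \ y) :=
        card_pos.2 (sdiff_nonempty.2 fun h => hne (hyz.antisymm h))
      have hle : #(z \ y) ≤ #yᶜ := card_le_card fun i hi => by simp_all
      simp only [hyz, hne, if_true, if_false, zero_add]
      exact inv_choose_eq_mul_inv_choose_pred _ _ hpos hle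
  · have hne : y ≠ z := fun h => hyz h.subset
    simp [hyz, hne]

lemma chainWeight_eq_zero {Z : Finset (Finset α)} {y : Finset α} (h : ∀ z ∈ Z, ¬ y ⊆ z) :
    chainWeight Z y = 0 := by
  rw [chainWeight, filter_false_of_mem h, sum_empty]

/-- If a random step up from a member of a convex family stays in the family with probability at
most `c`, a random chain meets the family at most `(1 - c)⁻¹` times on average. -/
lemma chainWeight_le_inv_one_sub {Z : Finset (Finset α)} {c : ℝ} (hc0 : 0 ≤ c) (hc1 : c < 1)
    (hconv : ∀ x y z : Finset α, x ∈ Z → z ∈ Z → x ⊆ y → y ⊆ z → y ∈ Z)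
    (hdeg : ∀ y ∈ Z, (#{i ∈ yᶜ | insert i y ∈ Z} : ℝ) ≤ c * #yᶜ) (y : Finset α) :
    chainWeight Z y ≤ (1 - c)⁻¹ := by
  have hM : 1 ≤ (1 - c)⁻¹ := (one_le_inv₀ (by linarith)).2 (by linarith)
  induction hm : #yᶜ generalizing y with
  | zero =>
    have hy : y = univ := by simpa using hm
    exact hy ▸ (chainWeight_univ_le_one Z).trans hM
  | succ m ih =>
    have hpos : (0 : ℝ) < #yᶜ := by rw [hm]; positivity
    have hstep : ∀ i ∈ yᶜ, chainWeight Z (insert i y) ≤ (1 - c)⁻¹ := fun i hi =>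
      ih _ (by rw [compl_insert, card_erase_of_mem hi, hm, Nat.add_sub_cancel])
    rw [chainWeight_eq_add_average Z y]
    split_ifs with hyZ
    · have hsum : ∑ i ∈ yᶜ, chainWeight Z (insert i y) ≤ c * #yᶜ * (1 - c)⁻¹ := by
        calc ∑ i ∈ yᶜ, chainWeight Z (insert i y)
            = ∑ i ∈ yᶜ with insert i y ∈ Z, chainWeight Z (insert i y) := by
              refine (sum_filter_of_ne fun i _ hne => ?_).symm
              by_contra hi
              exact hne (chainWeight_eq_zero fun z hz hiz =>
                hi (hconv y _ z hyZ hz (subset_insert i y) hiz))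
          _ ≤ #{i ∈ yᶜ | insert i y ∈ Z} • (1 - c)⁻¹ :=
              sum_le_card_nsmul _ _ _ fun i hi => hstep i (mem_filter.1 hi).1
          _ ≤ c * #yᶜ * (1 - c)⁻¹ := by
              rw [nsmul_eq_mul]
              exact mul_le_mul_of_nonneg_right (hdeg y hyZ) (by linarith)
      have hdiv : (∑ i ∈ yᶜ, chainWeight Z (insert i y)) / #yᶜ ≤ c * (1 - c)⁻¹ := by
        rw [div_le_iff₀ hpos]
        linarith
      have hid : (1 - c) * (1 - c)⁻¹ = 1 := mul_inv_cancel₀ (by linarith)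
      linarith
    · rw [zero_add, div_le_iff₀ hpos, mul_comm, ← nsmul_eq_mul]
      exact sum_le_card_nsmul _ _ _ hstep

lemma card_le_chainWeight_empty_mul_choose (Z : Finset (Finset α)) :
    (#Z : ℝ) ≤ chainWeight Z ∅ * (Fintype.card α).choose (Fintype.card α / 2) := by
  rw [chainWeight, sum_mul, filter_true_of_mem fun z _ => empty_subset z, ← nsmul_one]
  refine card_nsmul_le_sum _ _ _ fun z _ => ?_
  have hpos : (0 : ℝ) < (Fintype.card α).choose #z := by
    exact_mod_cast Nat.choose_pos (card_le_univ z)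
  rw [compl_empty, card_univ, sdiff_empty, inv_mul_eq_div, one_le_div hpos]
  exact_mod_cast Nat.choose_le_middle _ _

end

open Finset in
lemma card_insert_mem_le_dplus {n : ℕ} (Z : Finset (Finset (Fin n))) (y : Finset (Fin n)) :
    #{i ∈ yᶜ | insert i y ∈ Z} ≤ dplus (Z : Set (Finset (Fin n))) y := by
  rw [dplus, ← Set.ncard_coe_finset]
  refine Set.ncard_le_ncard_of_injOn (fun i => insert i y) (fun i hi => ?_)
    (fun i hi j hj hij => ?_) (Set.toFinite _)
  · obtain ⟨hi, hiZ⟩ := mem_filter.1 (mem_coe.1 hi)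
    exact ⟨hiZ, subset_insert i y, card_insert_of_notMem (mem_compl.1 hi)⟩
  · have hi' := mem_compl.1 (mem_filter.1 (mem_coe.1 hi)).1
    exact (insert_inj hi').1 hij

theorem convex_low_updegree_size_bound (n : ℕ) (hn : (0.4 : ℝ) * n ≤ ((n / 2 : ℕ) : ℝ))
    (b : ℝ) (hb : 0 < b) (hε : 2.5 * b / n < 1)
    (Z : Set (Finset (Fin n)))
    (hconv : ∀ x y z : Finset (Fin n), x ∈ Z → z ∈ Z → x ⊆ y → y ⊆ z → y ∈ Z)
    (hsize : ∀ y ∈ Z, (0.4 : ℝ) * n ≤ (y.card : ℝ) ∧ (y.card : ℝ) ≤ 0.6 * n)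
    (hdeg : ∀ y ∈ Z, (dplus Z y : ℝ) < b) :
    (Z.ncard : ℝ) ≤ (1 - 2.5 * b / n)⁻¹ * (n.choose (n / 2) : ℝ) := by
  obtain ⟨Z, rfl⟩ := Z.toFinite.exists_finset_coe
  simp only [Finset.mem_coe] at hconv hsize hdeg
  have hstep : ∀ y ∈ Z, ((yᶜ.filter fun i => insert i y ∈ Z).card : ℝ) ≤
      2.5 * b / n * (yᶜ.card : ℝ) := by
    intro y hy
    rcases Nat.eq_zero_or_pos n with rfl | hn0
    · simp [Finset.eq_empty_of_isEmpty]
    have hn0' : (0 : ℝ) < n := by exact_mod_cast hn0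
    have hd : ((yᶜ.filter fun i => insert i y ∈ Z).card : ℝ) ≤ dplus (Z : Set _) y := by
      exact_mod_cast card_insert_mem_le_dplus Z y
    have hcompl : (yᶜ.card : ℝ) = n - y.card := by
      rw [Finset.card_compl, Nat.cast_sub (Finset.card_le_univ y), Fintype.card_fin]
    have hb' : b = 2.5 * b / n * (0.4 * n) := by
      field_simp
      norm_num
    calc ((yᶜ.filter fun i => insert i y ∈ Z).card : ℝ) ≤ b := hd.trans (hdeg y hy).le
      _ = 2.5 * b / n * (0.4 * n) := hb'
      _ ≤ 2.5 * b / n * (yᶜ.card : ℝ) := by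
        refine mul_le_mul_of_nonneg_left ?_ (by positivity)
        linarith [(hsize y hy).2]
  have hcard := card_le_chainWeight_empty_mul_choose Z
  rw [Fintype.card_fin] at hcard
  rw [Set.ncard_coe_finset]
  exact hcard.trans (mul_le_mul_of_nonneg_right
    (chainWeight_le_inv_one_sub (by positivity) hε hconv hstep ∅) (by positivity))
end

section
/- Let G be a d-regular graph on n vertices, let 0 < k < 2d, and let Z be a nonempty set of vertices such that every vertex of Z has fewer than k neighbors in Z. Then |Z| < n·d/(2d − k), equivalently (2d − k)·|Z| < n·d. -/
/-- Counting the edges between a vertex and `Z` over all vertices sums the degrees over `Z`. -/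
theorem sum_card_neighborFinset_inter {V : Type*} [Fintype V] [DecidableEq V]
    (G : SimpleGraph V) [DecidableRel G.Adj] (Z : Finset V) :
    ∑ v, (G.neighborFinset v ∩ Z).card = ∑ v ∈ Z, G.degree v := by
  have h := Finset.sum_card_bipartiteAbove_eq_sum_card_bipartiteBelow
    (s := Finset.univ) (t := Z) G.Adj
  convert h using 3 with v _ v _
  · ext w
    simp [Finset.mem_bipartiteAbove, and_comm]
  · rw [← G.card_neighborFinset_eq_degree]
    congr 1
    ext w
    simp [Finset.mem_bipartiteBelow, G.adj_comm]

theorem size_bound_of_low_internal_degree (V : Type*) [Fintype V] (G : SimpleGraph V)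
    (d : ℕ) (hreg : ∀ v : V, (G.neighborSet v).ncard = d)
    (k : ℝ) (hk0 : 0 < k) (hk : k < 2 * d)
    (Z : Set V) (hZ : Z.Nonempty)
    (hdeg : ∀ v ∈ Z, ((G.neighborSet v ∩ Z).ncard : ℝ) < k) :
    (2 * d - k) * (Z.ncard : ℝ) < (Fintype.card V : ℝ) * d := by
  classical
  lift Z to Finset V using Z.toFinite
  have hdegree (v : V) : G.degree v = d := by
    rw [← hreg v, ← G.card_neighborFinset_eq_degree, ← Set.ncard_coe_finset,
      G.coe_neighborFinset]
  have hinter (v : V) :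
      (G.neighborSet v ∩ (Z : Set V)).ncard = (G.neighborFinset v ∩ Z).card := by
    rw [← Set.ncard_coe_finset, Finset.coe_inter, G.coe_neighborFinset]
  have hcount := sum_card_neighborFinset_inter G Z
  simp only [hdegree, Finset.sum_const, smul_eq_mul] at hcount
  rw [← Finset.sum_add_sum_compl Z] at hcount
  have hinside : ∑ v ∈ Z, ((G.neighborFinset v ∩ Z).card : ℝ) < Z.card * k := by
    rw [← nsmul_eq_mul, ← Finset.sum_const]
    refine Finset.sum_lt_sum_of_nonempty (Finset.coe_nonempty.mp hZ) fun v hv => ?_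
    simpa [hinter] using hdeg v hv
  have houtside : ∑ v ∈ Zᶜ, (G.neighborFinset v ∩ Z).card ≤ Zᶜ.card * d := by
    refine Finset.sum_le_card_nsmul _ _ _ fun v _ => ?_
    rw [← hdegree v, ← G.card_neighborFinset_eq_degree]
    exact Finset.card_le_card Finset.inter_subset_left
  have hcard : (Z.card : ℝ) + Zᶜ.card = Fintype.card V := by
    exact_mod_cast Finset.card_add_card_compl Z
  rify at hcount houtside
  rw [Set.ncard_coe_finset, ← hcard]
  linarith
end

section
/- For every integer d ≥ 5 with d ≡ 2 (mod 3), there exists a d-regular graph H on 2(d−2) vertices with mis(H) = 2 · 3^{(d−2)/3}. (Such a graph is obtained by taking two disjoint copies of the union of (d−2)/3 disjoint triangles and adding all edges between the two copies.) -/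
/-- The join, over `b : β`, of copies of the disjoint union of `ι` many cliques on `α`. -/
def joinOfCliques (β ι α : Type*) : SimpleGraph (β × ι × α) where
  Adj v w := v.1 ≠ w.1 ∨ v.2.1 = w.2.1 ∧ v.2.2 ≠ w.2.2
  symm := ⟨fun _ _ h => h.imp Ne.symm (And.imp Eq.symm Ne.symm)⟩
  loopless := ⟨fun _ h => h.elim (fun h => h rfl) fun h => h.2 rfl⟩

/-- The set of the vertices `p.2 i` of the `i`-th clique, for `i : ι`, in the copy `p.1`. -/
def cliqueTransversal {β ι α : Type*} (p : β × (ι → α)) : Set (β × ι × α) :=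
  {v | v.1 = p.1 ∧ v.2.2 = p.2 v.2.1}

theorem pairwise_not_adj_joinOfCliques_iff {β ι α : Type*} [Nonempty β] [Nonempty α]
    (s : Set (β × ι × α)) :
    (s.Pairwise fun a b => ¬ (joinOfCliques β ι α).Adj a b) ↔
      ∃ p, s ⊆ cliqueTransversal p := by
  constructor
  · intro hs
    have key : ∀ a ∈ s, ∀ b ∈ s, ¬ (joinOfCliques β ι α).Adj a b := fun a ha b hb => by
      by_cases hab : a = b
      · subst hab
        exact (joinOfCliques β ι α).irrefl
      · exact hs ha hb hab
    simp only [joinOfCliques, not_or, not_and, not_not] at key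
    have hb : ∃ b, ∀ v ∈ s, v.1 = b := by
      rcases s.eq_empty_or_nonempty with rfl | ⟨w, hw⟩
      · simp
      · exact ⟨w.1, fun v hv => (key v hv w hw).1⟩
    have hf : ∀ i, ∃ x, ∀ v ∈ s, v.2.1 = i → v.2.2 = x := fun i => by
      by_cases h : ∃ w ∈ s, w.2.1 = i
      · obtain ⟨w, hw, rfl⟩ := h
        exact ⟨w.2.2, fun v hv => (key v hv w hw).2⟩
      · push Not at h
        exact ⟨Classical.arbitrary α, fun v hv hi => (h v hv hi).elim⟩
    obtain ⟨b, hb⟩ := hb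
    choose f hf using hf
    exact ⟨(b, f), fun v hv => ⟨hb v hv, hf _ v hv rfl⟩⟩
  · rintro ⟨p, hp⟩ v hv w hw -
    obtain ⟨hv₁, hv₂⟩ := hp hv
    obtain ⟨hw₁, hw₂⟩ := hp hw
    rintro (h | ⟨h₁, h₂⟩)
    · exact h (hv₁.trans hw₁.symm)
    · exact h₂ (by rw [hv₂, hw₂, h₁])

theorem eq_of_cliqueTransversal_subset {β ι α : Type*} [Nonempty ι] {p q : β × (ι → α)}
    (h : cliqueTransversal p ⊆ cliqueTransversal q) : p = q := by
  have key : ∀ i, p.1 = q.1 ∧ p.2 i = q.2 i := fun i =>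
    h (show (p.1, i, p.2 i) ∈ cliqueTransversal p from ⟨rfl, rfl⟩)
  exact Prod.ext (key (Classical.arbitrary ι)).1 (funext fun i => (key i).2)

theorem mis_joinOfCliques (β ι α : Type*) [Nonempty β] [Finite ι] [Nonempty ι] [Nonempty α] :
    mis (joinOfCliques β ι α) = Nat.card β * Nat.card α ^ Nat.card ι := by
  have h : {I | Maximal (fun s : Set (β × ι × α) =>
      s.Pairwise fun a b => ¬ (joinOfCliques β ι α).Adj a b) I} =
      Set.range cliqueTransversal := by
    ext I
    simp only [pairwise_not_adj_joinOfCliques_iff, Set.mem_ofPred_eq, Set.mem_range]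
    constructor
    · rintro ⟨⟨p, hp⟩, hmax⟩
      exact ⟨p, (hmax ⟨p, subset_rfl⟩ hp).antisymm hp⟩
    · rintro ⟨p, rfl⟩
      refine ⟨⟨p, subset_rfl⟩, ?_⟩
      rintro t ⟨q, hq⟩ hpt
      rwa [eq_of_cliqueTransversal_subset (hpt.trans hq)]
  have hinj : Function.Injective (cliqueTransversal (β := β) (ι := ι) (α := α)) :=
    fun _ _ hpq => eq_of_cliqueTransversal_subset hpq.subset
  rw [mis, h, ← Nat.card_coe_set_eq, Nat.card_range_of_injective hinj, Nat.card_prod, Nat.card_fun]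

theorem ncard_neighborSet_joinOfCliques {ι α : Type*} [Finite ι] [Finite α]
    (v : Bool × ι × α) :
    ((joinOfCliques Bool ι α).neighborSet v).ncard =
      Nat.card ι * Nat.card α + (Nat.card α - 1) := by
  have h : (joinOfCliques Bool ι α).neighborSet v =
      ({!v.1} ×ˢ Set.univ) ∪ ({v.1} ×ˢ {v.2.1} ×ˢ {v.2.2}ᶜ) := by
    obtain ⟨b, i, x⟩ := v
    ext ⟨c, j, y⟩
    cases b <;> cases c <;> simp [joinOfCliques, SimpleGraph.mem_neighborSet, eq_comm]
  rw [h, Set.ncard_union_eq, Set.ncard_prod, Set.ncard_prod, Set.ncard_prod, Set.ncard_compl]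
  · simp [Set.ncard_univ]
  · rw [Set.disjoint_left]
    rintro w ⟨hw, -⟩ ⟨hw', -⟩
    simp_all

theorem exists_extremal_regular_graph (d : ℕ) (hd : 5 ≤ d) (hmod : d % 3 = 2) :
    ∃ (V : Type) (_ : Fintype V) (G : SimpleGraph V),
      Nat.card V = 2 * (d - 2) ∧
      (∀ v : V, (G.neighborSet v).ncard = d) ∧
      mis G = 2 * 3 ^ ((d - 2) / 3) := by
  have : NeZero ((d - 2) / 3) := ⟨by omega⟩
  refine ⟨Bool × Fin ((d - 2) / 3) × Fin 3, inferInstance, joinOfCliques _ _ _, ?_, fun v => ?_, ?_⟩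
  · rw [Nat.card_prod, Nat.card_prod, Nat.card_fin, Nat.card_fin, Nat.card_eq_fintype_card,
      Fintype.card_bool]
    omega
  · rw [ncard_neighborSet_joinOfCliques, Nat.card_fin, Nat.card_fin]
    omega
  · simp [mis_joinOfCliques]
end
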